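/- arXiv:2207.10753 — 14 statements merged into one kernel-verified Lean document; each statement's English description precedes it below -/
import Mathlib

section
/- Let F be a field, let R = F[x,y,z] be the polynomial ring in three variables, and let I ⊆ R be a homogeneous ideal contained in the irrelevant maximal ideal (x,y,z) such that A = R/I is finite-dimensional over F and the socle of A (the annihilator in A of the image of the ideal (x,y,z)) is a one-dimensional F-vector space (i.e., A is a standard graded Artinian Gorenstein algebra of embedding dimension at most 3). Let H(A)_i = dim_F of the image of the degree-i homogeneous component R_i in A. Then the Hilbert function H(A) is log-concave: for every i ≥ 1, H(A)_{i-1} · H(A)_{i+1} ≤ H(A)_i². -/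
/-- The socle of the Artinian algebra `A = F[x,y,z]/I`: the annihilator in `A`
of the image of the irrelevant maximal ideal `(x,y,z)`. -/
def gorensteinSocle (F : Type*) [Field F] (I : Ideal (MvPolynomial (Fin 3) F)) :
    Submodule F (MvPolynomial (Fin 3) F ⧸ I) where
  carrier := {a | ∀ v : Fin 3, a * Ideal.Quotient.mk I (MvPolynomial.X v) = 0}
  add_mem' := by
    intro a b ha hb v
    rw [add_mul, ha v, hb v, add_zero]
  zero_mem' := by
    intro v
    rw [zero_mul]
  smul_mem' := by
    intro c a ha v
    rw [smul_mul_assoc, ha v, smul_zero]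

open MvPolynomial

theorem Matrix.rank_map_algebraMap {F K m n : Type*} [Field F] [Field K] [Algebra F K]
    [Finite m] [Fintype n] (M : Matrix m n F) :
    (M.map (algebraMap F K)).rank = M.rank := by
  obtain ⟨κ, a, -, hspan, hli⟩ := exists_linearIndependent' F M.col
  have : Finite κ := hli.finite
  have := Fintype.ofFinite κ
  have hli' : LinearIndependent K ((M.map (algebraMap F K)).col ∘ a) :=
    linearIndependent_algebraMap_comp_iff (S := K) |>.2 hli
  have hspan' : Submodule.span K (Set.range ((M.map (algebraMap F K)).col ∘ a)) =
      Submodule.span K (Set.range (M.map (algebraMap F K)).col) := by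
    refine le_antisymm (Submodule.span_mono (Set.range_comp_subset_range _ _)) ?_
    rw [Submodule.span_le]
    rintro _ ⟨j, rfl⟩
    have hj : M.col j ∈ Submodule.span F (Set.range (M.col ∘ a)) :=
      hspan ▸ Submodule.subset_span ⟨j, rfl⟩
    obtain ⟨c, hc⟩ := (Submodule.mem_span_range_iff_exists_fun F).1 hj
    refine (Submodule.mem_span_range_iff_exists_fun K).2 ⟨fun k => algebraMap F K (c k), ?_⟩
    ext i
    simpa [Algebra.smul_def, Function.comp_def, Matrix.col_apply] using congrArg (algebraMap F K) (congrFun hc i)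
  rw [Matrix.rank_eq_finrank_span_cols, Matrix.rank_eq_finrank_span_cols, ← hspan, ← hspan',
    finrank_span_eq_card hli, finrank_span_eq_card hli']

theorem Submodule.finrank_map_eq_of_apply_eq_zero_iff {K V W W' : Type*} [Field K]
    [AddCommGroup V] [Module K V] [AddCommGroup W] [Module K W] [AddCommGroup W'] [Module K W']
    (f : V →ₗ[K] W) (g : V →ₗ[K] W') (p : Submodule K V) (h : ∀ x ∈ p, f x = 0 ↔ g x = 0) :
    Module.finrank K (p.map f) = Module.finrank K (p.map g) := by
  have hker : LinearMap.ker (f.domRestrict p) = LinearMap.ker (g.domRestrict p) := by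
    ext x
    simpa using h x x.2
  rw [← LinearMap.range_domRestrict, ← LinearMap.range_domRestrict]
  exact ((f.domRestrict p).quotKerEquivRange.symm.trans
    ((Submodule.quotEquivOfEq _ _ hker).trans (g.domRestrict p).quotKerEquivRange)).finrank_eq

theorem Submodule.finrank_add_finrank_le_of_sup_map {K V W : Type*} [Field K]
    [AddCommGroup V] [Module K V] [AddCommGroup W] [Module K W]
    (f : V →ₗ[K] W) {P Q : Submodule K V} {P' Q' : Submodule K W}
    [FiniteDimensional K P] [FiniteDimensional K Q']
    (hQP : Q ≤ P) (hQ : Q.map f ≤ Q') (hP : P' ≤ Q' ⊔ P.map f) :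
    Module.finrank K P' + Module.finrank K Q ≤ Module.finrank K P + Module.finrank K Q' := by
  obtain ⟨C, hC⟩ := Submodule.exists_isCompl (Q.comap P.subtype)
  set D := C.map P.subtype with hD
  have hsup : Q ⊔ D = P := by
    have := congrArg (Submodule.map P.subtype) hC.sup_eq_top
    rwa [Submodule.map_sup, Submodule.map_comap_subtype, inf_eq_right.2 hQP, Submodule.map_top,
      Submodule.range_subtype] at this
  have hcard : Module.finrank K Q + Module.finrank K D = Module.finrank K P := by
    rw [← Submodule.finrank_add_eq_of_isCompl hC, hD, Submodule.finrank_map_subtype_eq,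
      (Submodule.comapSubtypeEquivOfLe hQP).finrank_eq]
  have hP'' : P' ≤ Q' ⊔ D.map f := by
    refine hP.trans (sup_le le_sup_left ?_)
    rw [← hsup, Submodule.map_sup]
    exact sup_le_sup_right hQ _
  have : FiniteDimensional K D := by rw [hD]; infer_instance
  have h1 := Submodule.finrank_mono hP''
  have h2 := Submodule.finrank_add_le_finrank_add_finrank Q' (D.map f)
  have h3 := Submodule.finrank_map_le f D
  omega

theorem Finsupp.card_degree_eq_fin_three (n : ℕ) :
    Nat.card {d : Fin 3 →₀ ℕ // d.degree = n} = (n + 2).choose 2 := by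
  have h := Finset.card_finsuppAntidiag_nat_eq_choose (s := (Finset.univ : Finset (Fin 3))) n
  rw [Finset.card_univ, Fintype.card_fin, show 3 + n - 1 = n + 2 by omega,
    ← Nat.choose_symm (by omega : n ≤ n + 2), Nat.add_sub_cancel_left] at h
  rw [← h]
  refine Nat.subtype_card _ fun d => ?_
  simp [Finsupp.degree_eq_sum]

theorem MvPolynomial.finrank_homogeneousSubmodule_fin_three (K : Type*) [Field K] (n : ℕ) :
    Module.finrank K (homogeneousSubmodule (Fin 3) K n) = (n + 2).choose 2 := by
  rw [homogeneousSubmodule_eq_finsupp_supported, ← Finsupp.card_degree_eq_fin_three]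
  exact Module.finrank_eq_nat_card_basis (basisRestrictSupport K {d : Fin 3 →₀ ℕ | d.degree = n})

theorem Nat.choose_two_mul_choose_two_le_sq (n : ℕ) :
    (n + 2).choose 2 * (n + 4).choose 2 ≤ (n + 3).choose 2 * (n + 3).choose 2 := by
  have h (k : ℕ) : (k + 2).choose 2 * 2 = (k + 2) * (k + 1) := by
    rw [Nat.choose_two_right, Nat.add_succ_sub_one]
    exact Nat.div_mul_cancel (Nat.even_mul_pred_self (k + 2)).two_dvd
  have h0 := h n
  have h1 := h (n + 1)
  have h2 := h (n + 2)
  have : ((n + 2).choose 2 * 2) * ((n + 4).choose 2 * 2) ≤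
      ((n + 3).choose 2 * 2) * ((n + 3).choose 2 * 2) := by
    rw [h0, h1, h2]
    nlinarith
  nlinarith

namespace MvPolynomial

variable {σ K : Type*} [Field K]

/-- The contraction action on a functional `φ`: the polynomial `f` is sent to `g ↦ φ (f * g)`. -/
noncomputable def contraction (φ : Module.Dual K (MvPolynomial σ K)) :
    MvPolynomial σ K →ₗ[K] Module.Dual K (MvPolynomial σ K) :=
  (LinearMap.mul K (MvPolynomial σ K)).compr₂ φ

@[simp]
theorem contraction_apply (φ : Module.Dual K (MvPolynomial σ K)) (f g : MvPolynomial σ K) :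
    contraction φ f g = φ (f * g) := rfl

/-- The dimension of the space of contractions of `φ` by forms of degree `i`: the Hilbert function
of the Gorenstein algebra with dual generator `φ`. -/
noncomputable def contractionRank (φ : Module.Dual K (MvPolynomial σ K)) (i : ℕ) : ℕ :=
  Module.finrank K ((homogeneousSubmodule σ K i).map (contraction φ))

/-- A functional on polynomials that vanishes on all monomials of degree different from `e`. -/
def IsHomogeneousDual (φ : Module.Dual K (MvPolynomial σ K)) (e : ℕ) : Prop :=
  ∀ d : σ →₀ ℕ, d.degree ≠ e → φ (monomial d 1) = 0

theorem IsHomogeneousDual.apply_eq_zero {φ : Module.Dual K (MvPolynomial σ K)} {e k : ℕ}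
    (hφ : IsHomogeneousDual φ e) (hk : k ≠ e) {f : MvPolynomial σ K} (hf : f.IsHomogeneous k) :
    φ f = 0 := by
  rw [f.as_sum, map_sum]
  refine Finset.sum_eq_zero fun d hd => ?_
  have hdeg : d.degree = k := by
    by_contra h
    exact (mem_support_iff.1 hd) (hf.coeff_eq_zero h)
  rw [← mul_one (coeff d f), ← smul_eq_mul, ← smul_monomial, map_smul,
    hφ d (by rwa [hdeg]), smul_zero]

theorem homogeneousSubmodule_eq_span_monomial (i : ℕ) :
    homogeneousSubmodule σ K i =
      Submodule.span K (Set.range fun d : {d : σ →₀ ℕ // d.degree = i} => monomial d.1 1) := by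
  rw [homogeneousSubmodule_eq_finsupp_supported]
  refine (restrictSupport_eq_span K {d : σ →₀ ℕ | d.degree = i}).trans ?_
  rw [Set.image_eq_range]
  rfl

theorem contractionRank_eq_zero {φ : Module.Dual K (MvPolynomial σ K)} {e i : ℕ}
    (hφ : IsHomogeneousDual φ e) (hi : e < i) : contractionRank φ i = 0 := by
  have : (homogeneousSubmodule σ K i).map (contraction φ) = ⊥ := by
    rw [Submodule.eq_bot_iff]
    rintro _ ⟨f, hf, rfl⟩
    refine (basisMonomials σ K).ext fun d => ?_
    rw [coe_basisMonomials, LinearMap.zero_apply]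
    exact hφ.apply_eq_zero (by omega) (hf.mul (isHomogeneous_monomial 1 rfl))
  rw [contractionRank, this, finrank_bot]

/-- The catalecticant matrix of a functional. -/
noncomputable def catalecticant (φ : Module.Dual K (MvPolynomial σ K)) (i j : ℕ) :
    Matrix {d : σ →₀ ℕ // d.degree = i} {d : σ →₀ ℕ // d.degree = j} K :=
  .of fun a b => φ (monomial (a.1 + b.1) 1)

theorem catalecticant_transpose (φ : Module.Dual K (MvPolynomial σ K)) (i j : ℕ) :
    (catalecticant φ i j).transpose = catalecticant φ j i := by
  ext a b
  simp [catalecticant, add_comm]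

variable [Finite σ]

noncomputable instance (i : ℕ) : Fintype {d : σ →₀ ℕ // d.degree = i} :=
  (Finsupp.finite_of_degree_eq i).fintype

instance (i : ℕ) : FiniteDimensional K (homogeneousSubmodule σ K i) :=
  Module.Finite.iff_fg.2 (homogeneousSubmodule_fg σ K i)

theorem contractionRank_eq_rank {φ : Module.Dual K (MvPolynomial σ K)} {e i j : ℕ}
    (hφ : IsHomogeneousDual φ e) (hij : i + j = e) :
    contractionRank φ i = (catalecticant φ i j).rank := by
  let ρ : Module.Dual K (MvPolynomial σ K) →ₗ[K] ({d : σ →₀ ℕ // d.degree = j} → K) :=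
    LinearMap.pi fun b => Module.Dual.eval K _ (monomial b.1 1)
  have hρ : contractionRank φ i =
      Module.finrank K ((homogeneousSubmodule σ K i).map (ρ ∘ₗ contraction φ)) := by
    refine Submodule.finrank_map_eq_of_apply_eq_zero_iff _ _ _ fun f hf => ⟨fun h => ?_, fun h => ?_⟩
    · rw [LinearMap.comp_apply, h, map_zero]
    · refine (basisMonomials σ K).ext fun d => ?_
      rw [coe_basisMonomials, LinearMap.zero_apply]
      by_cases hd : d.degree = j
      · exact congrFun h ⟨d, hd⟩
      · exact hφ.apply_eq_zero (by omega) (hf.mul (isHomogeneous_monomial 1 rfl))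
  rw [hρ, homogeneousSubmodule_eq_span_monomial, Submodule.map_span, ← Set.range_comp,
    Matrix.rank_eq_finrank_span_row]
  have hrow : (⇑(ρ ∘ₗ contraction φ) ∘ fun d : {d : σ →₀ ℕ // d.degree = i} => monomial d.1 1) =
      (catalecticant φ i j).row := by
    ext a b
    simp [ρ, catalecticant, Matrix.row_apply]
  rw [hrow]

theorem contractionRank_symm {φ : Module.Dual K (MvPolynomial σ K)} {e i j : ℕ}
    (hφ : IsHomogeneousDual φ e) (hij : i + j = e) :
    contractionRank φ i = contractionRank φ j := by
  rw [contractionRank_eq_rank hφ hij, contractionRank_eq_rank hφ ((add_comm j i).trans hij),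
    ← catalecticant_transpose, Matrix.rank_transpose]

theorem exists_isHomogeneousDual_contractionRank_eq {F : Type*} (K : Type*) [Field F] [Field K]
    [Algebra F K] {φ : Module.Dual F (MvPolynomial σ F)} {e : ℕ} (hφ : IsHomogeneousDual φ e) :
    ∃ ψ : Module.Dual K (MvPolynomial σ K), IsHomogeneousDual ψ e ∧
      ∀ i, contractionRank ψ i = contractionRank φ i := by
  let ψ : Module.Dual K (MvPolynomial σ K) :=
    (basisMonomials σ K).constr K fun d => algebraMap F K (φ (monomial d 1))
  have hψ (d : σ →₀ ℕ) : ψ (monomial d 1) = algebraMap F K (φ (monomial d 1)) := by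
    simpa using (basisMonomials σ K).constr_basis K (fun d => algebraMap F K (φ (monomial d 1))) d
  have hψe : IsHomogeneousDual ψ e := fun d hd => by rw [hψ, hφ d hd, map_zero]
  refine ⟨ψ, hψe, fun i => ?_⟩
  rcases lt_or_ge e i with hi | hi
  · rw [contractionRank_eq_zero hφ hi, contractionRank_eq_zero hψe hi]
  · rw [contractionRank_eq_rank hφ (Nat.add_sub_of_le hi),
      contractionRank_eq_rank hψe (Nat.add_sub_of_le hi)]
    have hmap : catalecticant ψ i (e - i) = (catalecticant φ i (e - i)).map (algebraMap F K) := by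
      ext a b
      simp [catalecticant, hψ]
    rw [hmap, Matrix.rank_map_algebraMap]

end MvPolynomial

namespace MvPolynomial

variable {K : Type*} [Field K]

theorem exists_apply_ne_zero_and_eval_ne_zero [Infinite K] {σ : Type*} (i : σ)
    {f : MvPolynomial σ K} (hf : f ≠ 0) : ∃ p : σ → K, p i ≠ 0 ∧ eval p f ≠ 0 := by
  by_contra! h
  refine mul_ne_zero (X_ne_zero i) hf (MvPolynomial.funext fun p => ?_)
  by_cases hp : p i = 0
  · simp [hp]
  · simp [h p hp]

/-- The forms `l * a + m * b` with `a` and `b` homogeneous of degree `k`. -/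
noncomputable def pairMultiples {σ : Type*} (l m : MvPolynomial σ K) (k : ℕ) :
    Submodule K (MvPolynomial σ K) :=
  (homogeneousSubmodule σ K k).map (LinearMap.mulLeft K l) ⊔
    (homogeneousSubmodule σ K k).map (LinearMap.mulLeft K m)

section

variable {σ : Type*} {l m : MvPolynomial σ K} {j k : ℕ}

theorem mul_left_mem_pairMultiples {g : MvPolynomial σ K} (hg : g.IsHomogeneous k) :
    l * g ∈ pairMultiples l m k :=
  Submodule.mem_sup_left ⟨g, hg, rfl⟩

theorem mul_right_mem_pairMultiples {g : MvPolynomial σ K} (hg : g.IsHomogeneous k) :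
    m * g ∈ pairMultiples l m k :=
  Submodule.mem_sup_right ⟨g, hg, rfl⟩

theorem mul_mem_pairMultiples {g h : MvPolynomial σ K} (hg : g ∈ pairMultiples l m k)
    (hh : h.IsHomogeneous j) : h * g ∈ pairMultiples l m (j + k) := by
  obtain ⟨_, ⟨a, ha, rfl⟩, _, ⟨b, hb, rfl⟩, rfl⟩ := Submodule.mem_sup.1 hg
  rw [mul_add]
  refine add_mem ?_ ?_
  · rw [LinearMap.mulLeft_apply, mul_left_comm]
    exact mul_left_mem_pairMultiples (hh.mul ha)
  · rw [LinearMap.mulLeft_apply, mul_left_comm]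
    exact mul_right_mem_pairMultiples (hh.mul hb)

theorem homogeneousSubmodule_succ_le {N : Submodule K (MvPolynomial σ K)}
    (h : ∀ (v : σ) (g : MvPolynomial σ K), g.IsHomogeneous k → X v * g ∈ N) :
    homogeneousSubmodule σ K (k + 1) ≤ N := by
  rw [homogeneousSubmodule_eq_span_monomial, Submodule.span_le]
  rintro _ ⟨⟨d, hd⟩, rfl⟩
  obtain ⟨v, hv⟩ : ∃ v, d v ≠ 0 := by
    by_contra! h0
    have : d = 0 := Finsupp.ext h0
    simp [this] at hd
  obtain ⟨d', rfl⟩ : ∃ d', d = Finsupp.single v 1 + d' :=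
    ⟨d - Finsupp.single v 1, (add_tsub_cancel_of_le (by simpa [Nat.one_le_iff_ne_zero] using hv)).symm⟩
  have hd' : d'.degree = k := by
    rw [map_add, Finsupp.degree_single] at hd
    omega
  have := h v _ (isHomogeneous_monomial (1 : K) hd')
  rwa [X, monomial_mul, one_mul] at this

end

/-- Modulo two independent linear forms vanishing at `p`, all forms are multiples of powers of a
coordinate not vanishing at `p`. -/
theorem homogeneousSubmodule_succ_le_span_sup_pairMultiples {p : Fin 3 → K} (hp : p 0 ≠ 0) (k : ℕ) :
    homogeneousSubmodule (Fin 3) K (k + 1) ≤ Submodule.span K {X 0 ^ (k + 1)} ⊔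
      pairMultiples (C (p 0) * X 1 - C (p 1) * X 0) (C (p 0) * X 2 - C (p 2) * X 0) k := by
  set l : MvPolynomial (Fin 3) K := C (p 0) * X 1 - C (p 1) * X 0 with hl
  set m : MvPolynomial (Fin 3) K := C (p 0) * X 2 - C (p 2) * X 0 with hm
  have hpp : (C (p 0)⁻¹ * C (p 0) : MvPolynomial (Fin 3) K) = 1 := by
    rw [← C_mul, inv_mul_cancel₀ hp, C_1]
  have reduce (k : ℕ) (h : ∀ g : MvPolynomial (Fin 3) K, g.IsHomogeneous k →
      X 0 * g ∈ Submodule.span K {X 0 ^ (k + 1)} ⊔ pairMultiples l m k) :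
      homogeneousSubmodule (Fin 3) K (k + 1) ≤
        Submodule.span K {X 0 ^ (k + 1)} ⊔ pairMultiples l m k := by
    refine homogeneousSubmodule_succ_le fun v g hg => ?_
    fin_cases v
    · exact h g hg
    · have hX : X 1 * g = (p 0)⁻¹ • (p 1 • (X 0 * g) + l * g) := by
        simp only [smul_eq_C_mul, hl]
        linear_combination -(X 1 * g) * hpp
      change X 1 * g ∈ _
      rw [hX]
      exact Submodule.smul_mem _ _ (add_mem (Submodule.smul_mem _ _ (h g hg))
        (Submodule.mem_sup_right (mul_left_mem_pairMultiples hg)))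
    · have hX : X 2 * g = (p 0)⁻¹ • (p 2 • (X 0 * g) + m * g) := by
        simp only [smul_eq_C_mul, hm]
        linear_combination -(X 2 * g) * hpp
      change X 2 * g ∈ _
      rw [hX]
      exact Submodule.smul_mem _ _ (add_mem (Submodule.smul_mem _ _ (h g hg))
        (Submodule.mem_sup_right (mul_right_mem_pairMultiples hg)))
  induction k with
  | zero =>
    refine reduce 0 fun g hg => Submodule.mem_sup_left ?_
    rw [← mem_homogeneousSubmodule, homogeneousSubmodule_zero] at hg
    obtain ⟨c, rfl⟩ := Submodule.mem_one.1 hg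
    refine Submodule.mem_span_singleton.2 ⟨c, ?_⟩
    rw [smul_eq_C_mul, algebraMap_eq]
    ring
  | succ k ih =>
    refine reduce (k + 1) fun g hg => ?_
    obtain ⟨u, hu, w, hw, rfl⟩ := Submodule.mem_sup.1 (ih hg)
    obtain ⟨c, rfl⟩ := Submodule.mem_span_singleton.1 hu
    rw [mul_add]
    refine add_mem (Submodule.mem_sup_left (Submodule.mem_span_singleton.2 ⟨c, ?_⟩))
      (Submodule.mem_sup_right ?_)
    · rw [mul_smul_comm, ← pow_succ']
    · rw [add_comm k 1]
      exact mul_mem_pairMultiples hw (isHomogeneous_X K 0)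

/-- Over an infinite field, every nonzero ternary form of degree `n + 1` generates, together with
two suitable linear forms, all forms of degree greater than `n`. -/
theorem exists_linear_forms_homogeneousSubmodule_le [Infinite K] {f : MvPolynomial (Fin 3) K}
    {n : ℕ} (hf : f.IsHomogeneous (n + 1)) (hf0 : f ≠ 0) :
    ∃ l m : MvPolynomial (Fin 3) K, l.IsHomogeneous 1 ∧ m.IsHomogeneous 1 ∧ ∀ k, n ≤ k →
      homogeneousSubmodule (Fin 3) K (k + 1) ≤
        (Ideal.span {f}).restrictScalars K ⊔ pairMultiples l m k := by
  obtain ⟨p, hp, hpf⟩ := exists_apply_ne_zero_and_eval_ne_zero 0 hf0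
  refine ⟨C (p 0) * X 1 - C (p 1) * X 0, C (p 0) * X 2 - C (p 2) * X 0,
    (isHomogeneous_C_mul_X _ _).sub (isHomogeneous_C_mul_X _ _),
    (isHomogeneous_C_mul_X _ _).sub (isHomogeneous_C_mul_X _ _), fun k hk => ?_⟩
  refine (homogeneousSubmodule_succ_le_span_sup_pairMultiples hp k).trans (sup_le ?_ le_sup_right)
  obtain ⟨u, hu, w, hw, rfl⟩ :=
    Submodule.mem_sup.1 (homogeneousSubmodule_succ_le_span_sup_pairMultiples hp n hf)
  obtain ⟨c, rfl⟩ := Submodule.mem_span_singleton.1 hu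
  have hc : c ≠ 0 := by
    rintro rfl
    obtain ⟨_, ⟨a, -, rfl⟩, _, ⟨b, -, rfl⟩, rfl⟩ := Submodule.mem_sup.1 hw
    refine hpf ?_
    simp [mul_comm]
  obtain ⟨j, rfl⟩ := Nat.exists_eq_add_of_le' hk
  rw [Submodule.span_singleton_le_iff_mem]
  have hcc : (C c⁻¹ * C c : MvPolynomial (Fin 3) K) = 1 := by
    rw [← C_mul, inv_mul_cancel₀ hc, C_1]
  have hX : (X 0 : MvPolynomial (Fin 3) K) ^ (j + n + 1) =
      (C c⁻¹ * X 0 ^ j) * (c • X 0 ^ (n + 1) + w) - c⁻¹ • (X 0 ^ j * w) := by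
    simp only [smul_eq_C_mul]
    linear_combination -(X 0 ^ (j + n + 1)) * hcc
  rw [hX]
  refine sub_mem (Submodule.mem_sup_left ?_) (Submodule.mem_sup_right (Submodule.smul_mem _ _
    (mul_mem_pairMultiples hw (isHomogeneous_X_pow 0 j))))
  exact Ideal.mul_mem_left _ _ (Ideal.mem_span_singleton_self _)

theorem exists_contractionRank_add_le [Infinite K] {φ : Module.Dual K (MvPolynomial (Fin 3) K)}
    {e n : ℕ} (hφ : IsHomogeneousDual φ (e + 1)) {f : MvPolynomial (Fin 3) K}
    (hf : f.IsHomogeneous (n + 1)) (hf0 : f ≠ 0) (hφf : contraction φ f = 0) :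
    ∃ χ : Module.Dual K (MvPolynomial (Fin 3) K), IsHomogeneousDual χ e ∧ ∀ k, n ≤ k + 1 →
      contractionRank φ (k + 2) + contractionRank χ k ≤
        contractionRank φ (k + 1) + contractionRank χ (k + 1) := by
  obtain ⟨l, m, hl, hm, hlm⟩ := exists_linear_forms_homogeneousSubmodule_le hf hf0
  have hχ (g : MvPolynomial (Fin 3) K) :
      contraction (contraction φ l) g = contraction φ (l * g) := by
    ext; simp [mul_assoc]
  have hT (g : MvPolynomial (Fin 3) K) :
      (LinearMap.mulLeft K m).dualMap (contraction φ g) = contraction φ (m * g) := by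
    refine LinearMap.ext fun h => ?_
    simp only [LinearMap.dualMap_apply, LinearMap.mulLeft_apply, contraction_apply]
    rw [← mul_assoc, mul_comm g]
  refine ⟨contraction φ l, fun d hd => hφ.apply_eq_zero (k := 1 + d.degree) (by omega)
    (hl.mul (isHomogeneous_monomial 1 rfl)), fun k hk => ?_⟩
  refine Submodule.finrank_add_finrank_le_of_sup_map (LinearMap.mulLeft K m).dualMap ?_ ?_ ?_
  · rintro _ ⟨g, hg, rfl⟩
    rw [hχ]
    exact ⟨l * g, add_comm 1 k ▸ hl.mul hg, rfl⟩
  · rintro _ ⟨_, ⟨g, hg, rfl⟩, rfl⟩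
    rw [hχ, hT, mul_left_comm, ← hχ]
    exact ⟨m * g, add_comm 1 k ▸ hm.mul hg, rfl⟩
  · rintro _ ⟨g, hg, rfl⟩
    obtain ⟨u, hu, w, hw, rfl⟩ := Submodule.mem_sup.1 (hlm (k + 1) hk hg)
    obtain ⟨_, ⟨a, ha, rfl⟩, _, ⟨b, hb, rfl⟩, rfl⟩ := Submodule.mem_sup.1 hw
    obtain ⟨c, rfl⟩ := Ideal.mem_span_singleton'.1 hu
    have hcf : contraction φ (c * f) = 0 := by
      refine LinearMap.ext fun h => ?_
      have := LinearMap.congr_fun hφf (c * h)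
      rwa [contraction_apply, mul_left_comm, ← mul_assoc] at this
    rw [map_add, map_add, hcf, zero_add, LinearMap.mulLeft_apply, LinearMap.mulLeft_apply, ← hχ,
      ← hT]
    exact add_mem (Submodule.mem_sup_left ⟨a, ha, rfl⟩)
      (Submodule.mem_sup_right ⟨_, ⟨b, hb, rfl⟩, rfl⟩)

theorem contractionRank_mul_le_of_two_mul_le [Infinite K]
    {φ : Module.Dual K (MvPolynomial (Fin 3) K)} {e i : ℕ} (hφ : IsHomogeneousDual φ e)
    (hi : 2 * (i + 1) ≤ e) :
    contractionRank φ i * contractionRank φ (i + 2) ≤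
      contractionRank φ (i + 1) * contractionRank φ (i + 1) := by
  by_cases h : ∃ f : MvPolynomial (Fin 3) K, f.IsHomogeneous (i + 2) ∧ f ≠ 0 ∧ contraction φ f = 0
  · obtain ⟨f, hf, hf0, hφf⟩ := h
    obtain ⟨j, rfl⟩ : ∃ j, e = j + i + 2 := ⟨e - (i + 2), by omega⟩
    obtain ⟨χ, hχ, hle⟩ := exists_contractionRank_add_le (e := j + i + 1) hφ hf hf0 hφf
    have h1 := hle i le_rfl
    have h2 := hle j (by omega)
    rw [contractionRank_symm hφ (show j + 2 + i = j + i + 2 by omega),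
      contractionRank_symm hφ (show j + 1 + (i + 1) = j + i + 2 by omega),
      contractionRank_symm hχ (show j + (i + 1) = j + i + 1 by omega),
      contractionRank_symm hχ (show j + 1 + i = j + i + 1 by omega)] at h2
    have h3 : contractionRank φ i + contractionRank φ (i + 2) ≤ 2 * contractionRank φ (i + 1) := by
      omega
    zify at h3 ⊢
    nlinarith [sq_nonneg ((contractionRank φ i : ℤ) - contractionRank φ (i + 2))]
  · push Not at h
    have hfull (k : ℕ) (hk : k ≤ i + 2) : contractionRank φ k = (k + 2).choose 2 := by
      rw [← finrank_homogeneousSubmodule_fin_three K k, contractionRank]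
      conv_rhs => rw [← Submodule.map_id (homogeneousSubmodule (Fin 3) K k)]
      refine Submodule.finrank_map_eq_of_apply_eq_zero_iff _ _ _ fun g hg => ⟨fun h0 => ?_, ?_⟩
      · by_contra hg0
        refine h (X 0 ^ (i + 2 - k) * g) ?_ (mul_ne_zero (pow_ne_zero _ (X_ne_zero 0)) hg0) ?_
        · have := (isHomogeneous_X_pow (R := K) (0 : Fin 3) (i + 2 - k)).mul hg
          rwa [Nat.sub_add_cancel hk] at this
        · refine LinearMap.ext fun q => ?_
          have := LinearMap.congr_fun h0 (X 0 ^ (i + 2 - k) * q)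
          rwa [contraction_apply, mul_left_comm, ← mul_assoc] at this
      · rintro (rfl : g = 0)
        exact map_zero _
    rw [hfull i (by omega), hfull (i + 1) (by omega), hfull (i + 2) le_rfl]
    exact Nat.choose_two_mul_choose_two_le_sq i

theorem contractionRank_mul_le_of_infinite [Infinite K]
    {φ : Module.Dual K (MvPolynomial (Fin 3) K)} {e : ℕ} (hφ : IsHomogeneousDual φ e) (i : ℕ) :
    contractionRank φ i * contractionRank φ (i + 2) ≤
      contractionRank φ (i + 1) * contractionRank φ (i + 1) := by
  rcases lt_or_ge e (i + 2) with hi | hi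
  · rw [contractionRank_eq_zero hφ hi, mul_zero]
    exact Nat.zero_le _
  obtain ⟨j, rfl⟩ := Nat.exists_eq_add_of_le' hi
  rcases le_total i j with hij | hij
  · exact contractionRank_mul_le_of_two_mul_le hφ (by omega)
  · rw [contractionRank_symm hφ (show i + (j + 2) = j + (i + 2) by omega),
      contractionRank_symm hφ (show i + 1 + (j + 1) = j + (i + 2) by omega),
      contractionRank_symm hφ (show i + 2 + j = j + (i + 2) by omega), mul_comm]
    exact contractionRank_mul_le_of_two_mul_le hφ (by omega)

theorem contractionRank_mul_le {φ : Module.Dual K (MvPolynomial (Fin 3) K)} {e : ℕ}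
    (hφ : IsHomogeneousDual φ e) (i : ℕ) :
    contractionRank φ i * contractionRank φ (i + 2) ≤
      contractionRank φ (i + 1) * contractionRank φ (i + 1) := by
  obtain ⟨ψ, hψ, h⟩ := exists_isHomogeneousDual_contractionRank_eq (AlgebraicClosure K) hφ
  simpa only [h] using contractionRank_mul_le_of_infinite hψ i

end MvPolynomial

namespace MvPolynomial

section

variable {σ F : Type*} [Field F] {I : Ideal (MvPolynomial σ F)}

theorem exists_X_pow_mem (hhom : ∀ f ∈ I, ∀ n : ℕ, homogeneousComponent n f ∈ I)
    [FiniteDimensional F (MvPolynomial σ F ⧸ I)] (v : σ) : ∃ n : ℕ, (X v) ^ n ∈ I := by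
  obtain ⟨p, hp, hpv⟩ := IsIntegral.of_finite F (Ideal.Quotient.mkₐ F I (X v))
  rw [← Polynomial.aeval_def, Polynomial.aeval_algHom_apply, Ideal.Quotient.mkₐ_eq_mk,
    Ideal.Quotient.eq_zero_iff_mem] at hpv
  refine ⟨p.natDegree, ?_⟩
  have h := hhom _ hpv p.natDegree
  rw [Polynomial.aeval_eq_sum_range, map_sum, Finset.sum_eq_single p.natDegree] at h
  · rwa [hp.coeff_natDegree, one_smul,
      homogeneousComponent_eq_self (isHomogeneous_X_pow v p.natDegree)] at h
  · intro k _ hk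
    rw [map_smul, homogeneousComponent_of_mem (isHomogeneous_X_pow v k), if_neg hk.symm, smul_zero]
  · simp

theorem exists_forall_homogeneousSubmodule_le [Fintype σ]
    (hhom : ∀ f ∈ I, ∀ n : ℕ, homogeneousComponent n f ∈ I)
    [FiniteDimensional F (MvPolynomial σ F ⧸ I)] :
    ∃ N : ℕ, ∀ k, N ≤ k → homogeneousSubmodule σ F k ≤ I.restrictScalars F := by
  choose n hn using fun v => exists_X_pow_mem hhom v
  refine ⟨∑ v, n v + 1, fun k hk => ?_⟩
  rw [homogeneousSubmodule_eq_span_monomial, Submodule.span_le]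
  rintro _ ⟨⟨d, rfl⟩, rfl⟩
  obtain ⟨v, -, hv⟩ : ∃ v ∈ Finset.univ, n v < d v := by
    refine Finset.exists_lt_of_sum_lt ?_
    rw [← Finsupp.degree_eq_sum]
    omega
  refine I.mem_of_dvd ?_ (hn v)
  rw [X_pow_eq_monomial, monomial_dvd_monomial]
  exact ⟨Or.inr (by simpa using hv.le), one_dvd 1⟩

end

/-- A graded Artinian Gorenstein quotient of a polynomial ring has a homogeneous dual generator. -/
theorem exists_isHomogeneousDual_contraction_eq_zero_iff {F : Type*} [Field F]
    {I : Ideal (MvPolynomial (Fin 3) F)}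
    (hhom : ∀ f ∈ I, ∀ n : ℕ, homogeneousComponent n f ∈ I) (hI : I ≠ ⊤)
    [FiniteDimensional F (MvPolynomial (Fin 3) F ⧸ I)]
    (hgor : Module.finrank F (gorensteinSocle F I) = 1) :
    ∃ (φ : Module.Dual F (MvPolynomial (Fin 3) F)) (e : ℕ), IsHomogeneousDual φ e ∧
      ∀ (i : ℕ) (f : MvPolynomial (Fin 3) F), f.IsHomogeneous i →
        (contraction φ f = 0 ↔ f ∈ I) := by
  classical
  have hN := exists_forall_homogeneousSubmodule_le hhom
  obtain ⟨e, s, hs, hsI, hlt⟩ : ∃ (e : ℕ) (s : MvPolynomial (Fin 3) F), s.IsHomogeneous e ∧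
      s ∉ I ∧ ∀ k, e < k → ∀ f : MvPolynomial (Fin 3) F, f.IsHomogeneous k → f ∈ I := by
    have hspec := Nat.find_spec hN
    have hpos : Nat.find hN ≠ 0 := fun h0 =>
      hI ((Ideal.eq_top_iff_one I).2 (hspec 0 h0.le (isHomogeneous_one (Fin 3) F)))
    have hmin := Nat.find_min hN (Nat.sub_one_lt hpos)
    simp only [not_forall, SetLike.not_le_iff_exists] at hmin
    obtain ⟨k, hk, s, hs, hsI⟩ := hmin
    refine ⟨k, s, hs, hsI, fun j hj f hf => hspec j (by omega) hf⟩
  have hsocle (f : MvPolynomial (Fin 3) F) (hf : ∀ v, X v * f ∈ I) :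
      Ideal.Quotient.mk I f ∈ gorensteinSocle F I := fun v => by
    rw [← map_mul, Ideal.Quotient.eq_zero_iff_mem, mul_comm]
    exact hf v
  have htop (f : MvPolynomial (Fin 3) F) (hf : f.IsHomogeneous e) (v : Fin 3) : X v * f ∈ I :=
    hlt (1 + e) (by omega) _ ((isHomogeneous_X F v).mul hf)
  have hspan (f : MvPolynomial (Fin 3) F) (hf : ∀ v, X v * f ∈ I) : ∃ c : F, f - c • s ∈ I := by
    have hne : (⟨_, hsocle s (htop s hs)⟩ : gorensteinSocle F I) ≠ 0 := fun h0 =>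
      hsI (Ideal.Quotient.eq_zero_iff_mem.1 (congrArg Subtype.val h0))
    obtain ⟨c, hc⟩ := (finrank_eq_one_iff_of_nonzero' _ hne).1 hgor ⟨_, hsocle f hf⟩
    refine ⟨c, (Ideal.Quotient.mk_eq_mk_iff_sub_mem _ _).1 ?_⟩
    exact (congrArg Subtype.val hc).symm
  obtain ⟨ε, hε⟩ : ∃ ε : Module.Dual F (MvPolynomial (Fin 3) F ⧸ I),
      ε (Ideal.Quotient.mkₐ F I s) ≠ 0 := by
    by_contra! h
    exact hsI (Ideal.Quotient.eq_zero_iff_mem.1 ((Module.forall_dual_apply_eq_zero_iff F _).1 h))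
  let φ : Module.Dual F (MvPolynomial (Fin 3) F) :=
    ε ∘ₗ (Ideal.Quotient.mkₐ F I).toLinearMap ∘ₗ homogeneousComponent e
  have hφ (f : MvPolynomial (Fin 3) F) :
      φ f = ε (Ideal.Quotient.mkₐ F I (homogeneousComponent e f)) := rfl
  have hφI (f : MvPolynomial (Fin 3) F) (hf : f ∈ I) : φ f = 0 := by
    rw [hφ, Ideal.Quotient.mkₐ_eq_mk, Ideal.Quotient.eq_zero_iff_mem.2 (hhom f hf e), map_zero]
  have hnondeg (n : ℕ) : ∀ (i : ℕ), i + n = e → ∀ f : MvPolynomial (Fin 3) F, f.IsHomogeneous i →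
      contraction φ f = 0 → f ∈ I := by
    induction n with
    | zero =>
      rintro i rfl f hf h0
      obtain ⟨c, hc⟩ := hspan f (htop f hf)
      have h1 : φ f = 0 := by simpa using LinearMap.congr_fun h0 1
      have h2 : φ (f - c • s) = 0 := hφI _ hc
      rw [map_sub, h1, map_smul, zero_sub, neg_eq_zero, smul_eq_zero, hφ s,
        homogeneousComponent_eq_self hs, or_iff_left hε] at h2
      simpa [h2] using hc
    | succ n ih =>
      intro i hi f hf h0
      obtain ⟨c, hc⟩ := hspan f fun v => by
        refine ih (1 + i) (by omega) _ ((isHomogeneous_X F v).mul hf) (LinearMap.ext fun g => ?_)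
        have := LinearMap.congr_fun h0 (X v * g)
        rwa [contraction_apply, mul_left_comm, ← mul_assoc] at this
      have := hhom _ hc i
      rwa [map_sub, map_smul, homogeneousComponent_eq_self hf, homogeneousComponent_of_mem hs,
        if_neg (by omega), smul_zero, sub_zero] at this
  refine ⟨φ, e, fun d hd => ?_, fun i f hf => ⟨fun h0 => ?_, fun hfI => ?_⟩⟩
  · rw [hφ, homogeneousComponent_of_mem (isHomogeneous_monomial 1 rfl), if_neg hd.symm, map_zero,
      map_zero]
  · rcases lt_or_ge e i with hi | hi
    · exact hlt i hi f hf
    · exact hnondeg (e - i) i (by omega) f hf h0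
  · exact LinearMap.ext fun g => hφI _ (I.mul_mem_right g hfI)

end MvPolynomial

/-- Codimension three Artinian Gorenstein Hilbert functions are log-concave. -/
theorem codim_three_gorenstein_log_concave
    (F : Type*) [Field F] (I : Ideal (MvPolynomial (Fin 3) F))
    (hhom : ∀ f ∈ I, ∀ n : ℕ, MvPolynomial.homogeneousComponent n f ∈ I)
    (hirr : I ≤ Ideal.span (Set.range (MvPolynomial.X : Fin 3 → MvPolynomial (Fin 3) F)))
    (hfin : FiniteDimensional F (MvPolynomial (Fin 3) F ⧸ I))
    (hgor : Module.finrank F (gorensteinSocle F I) = 1)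
    (H : ℕ → ℕ)
    (hH : ∀ i : ℕ, H i = Module.finrank F
      ((MvPolynomial.homogeneousSubmodule (Fin 3) F i).map
        (Ideal.Quotient.mkₐ F I).toLinearMap)) :
    ∀ i : ℕ, 1 ≤ i → H (i - 1) * H (i + 1) ≤ H i * H i := by
  have hI : I ≠ ⊤ := by
    rintro rfl
    have hle : Ideal.span (Set.range (X : Fin 3 → MvPolynomial (Fin 3) F)) ≤
        RingHom.ker (constantCoeff (σ := Fin 3) (R := F)) := by
      rw [Ideal.span_le]
      rintro _ ⟨v, rfl⟩
      exact constantCoeff_X F v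
    simpa using hle (hirr (Submodule.mem_top (x := 1)))
  obtain ⟨φ, e, hφ, hφI⟩ := exists_isHomogeneousDual_contraction_eq_zero_iff hhom hI hgor
  have hrank (i : ℕ) : H i = contractionRank φ i := by
    rw [hH]
    refine Submodule.finrank_map_eq_of_apply_eq_zero_iff _ _ _ fun f hf => ?_
    rw [hφI i f hf]
    exact Ideal.Quotient.eq_zero_iff_mem
  rintro (_ | i) hi
  · exact absurd hi (by omega)
  · simpa only [hrank, Nat.add_sub_cancel] using contractionRank_mul_le hφ i
end

section
/- Every SI sequence H = (h_0, h_1, …, h_j) with h_0 = 1 and h_1 = 3 is log-concave: for every 1 ≤ i ≤ j−1, h_{i-1}·h_{i+1} ≤ h_i². (Since by the Buchsbaum–Eisenbud structure theorem the codimension three Gorenstein sequences are exactly the SI sequences with h_1 = 3, this says every codimension three Gorenstein sequence is log-concave.) -/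
/-- `g` restricted to degrees `0,…,m` is a Macaulay (O-)sequence: `g 0 = 1` and for
every `1 ≤ a ≤ m - 1` there is a Macaulay expansion `g a = Σ_{i=1}^a C(n i, i)` with
`n a > n (a-1) > ⋯ > n 1 ≥ 0` witnessing Macaulay growth `g (a+1) ≤ Σ_{i=1}^a C(n i + 1, i+1)`. -/
def IsMacaulaySeq (g : ℕ → ℕ) (m : ℕ) : Prop :=
  g 0 = 1 ∧ ∀ a : ℕ, 1 ≤ a → a + 1 ≤ m →
    ∃ n : ℕ → ℕ, (∀ i : ℕ, 1 ≤ i → i < a → n i < n (i + 1)) ∧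
      g a = ∑ i ∈ Finset.Icc 1 a, Nat.choose (n i) i ∧
      g (a + 1) ≤ ∑ i ∈ Finset.Icc 1 a, Nat.choose (n i + 1) (i + 1)

/-- `h` is an SI sequence of socle degree `j`: it is symmetric, and its first
difference (with `h (-1) = 0`), restricted to degrees `0,…,⌊j/2⌋`, is nonnegative
and a Macaulay sequence. -/
def IsSISeq (h : ℕ → ℕ) (j : ℕ) : Prop :=
  (∀ i ≤ j, h i = h (j - i)) ∧
  (∀ i : ℕ, 1 ≤ i → i ≤ j / 2 → h (i - 1) ≤ h i) ∧
  IsMacaulaySeq (fun i => if i = 0 then h 0 else h i - h (i - 1)) (j / 2)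

/-- Macaulay growth in two variables: if a degree-`a` Macaulay expansion has value `s ≤ a + 1`,
then its growth is at most `s`, unless `s = a + 1`, when it is at most `a + 2`. -/
theorem macaulay_growth_of_le_succ (a : ℕ) (ha : 1 ≤ a) (n : ℕ → ℕ)
    (hn : ∀ i : ℕ, 1 ≤ i → i < a → n i < n (i + 1))
    (hs : ∑ i ∈ Finset.Icc 1 a, Nat.choose (n i) i ≤ a + 1) :
    ∑ i ∈ Finset.Icc 1 a, Nat.choose (n i + 1) (i + 1)
        ≤ ∑ i ∈ Finset.Icc 1 a, Nat.choose (n i) i ∨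
      (∑ i ∈ Finset.Icc 1 a, Nat.choose (n i) i = a + 1 ∧
        ∑ i ∈ Finset.Icc 1 a, Nat.choose (n i + 1) (i + 1) ≤ a + 2) := by
  have hmono : ∀ k i : ℕ, 1 ≤ i → i + k = a → n i + k ≤ n a := by
    intro k
    induction k with
    | zero => rintro i - rfl; simp
    | succ k ih =>
      intro i hi hik
      have h1 := ih (i + 1) (by omega) (by omega)
      have h2 := hn i hi (by omega)
      omega
  rcases Nat.lt_or_ge a (n a) with hna | hna
  · obtain ⟨b, rfl⟩ : ∃ b, a = b + 1 := ⟨a - 1, by omega⟩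
    rw [Finset.sum_Icc_succ_top (by omega)] at hs
    have hna' : n (b + 1) = b + 2 := by
      by_contra hne
      have h1 : Nat.choose (b + 3) (b + 1) ≤ Nat.choose (n (b + 1)) (b + 1) :=
        Nat.choose_le_choose _ (by omega)
      have h2 : Nat.choose (b + 3) (b + 1) = Nat.choose (b + 3) 2 :=
        Nat.choose_symm_of_eq_add (by omega)
      rw [Nat.choose_two_right] at h2
      have h4 : (b + 3) * (b + 3 - 1) = 2 * (b + 2) + (b + 1) * (b + 2) := by
        rw [show b + 3 - 1 = b + 2 by omega]; ring
      have h5 : 2 ≤ (b + 1) * (b + 2) := by nlinarith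
      omega
    have hc : Nat.choose (n (b + 1)) (b + 1) = b + 2 := by
      rw [hna', Nat.choose_succ_self_right]
    have hz : ∑ i ∈ Finset.Icc 1 b, Nat.choose (n i) i = 0 := by omega
    have hz' : ∑ i ∈ Finset.Icc 1 b, Nat.choose (n i + 1) (i + 1) = 0 := by
      rw [Finset.sum_eq_zero_iff] at hz ⊢
      intro i hi
      have := Nat.choose_eq_zero_iff.mp (hz i hi)
      exact Nat.choose_eq_zero_iff.mpr (by omega)
    right
    rw [Finset.sum_Icc_succ_top (by omega), Finset.sum_Icc_succ_top (by omega), hz, hz', hc,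
      hna', Nat.choose_succ_self_right]
    omega
  · left
    refine Finset.sum_le_sum fun i hi => ?_
    rw [Finset.mem_Icc] at hi
    have h1 := hmono (a - i) i hi.1 (by omega)
    rcases Nat.lt_or_ge (n i) i with h2 | h2
    · rw [Nat.choose_eq_zero_of_lt (by omega : n i + 1 < i + 1)]
      exact Nat.zero_le _
    · have h3 : n i = i := by omega
      simp [h3]

/-- The first difference of an SI sequence starting `1, 3` is, in each degree up to the middle,
either as large as possible (as are all earlier ones) or at most the degree. -/
theorem IsSISeq.diff_maximal_or_le {j : ℕ} {h : ℕ → ℕ} (hSI : IsSISeq h j) (h0 : h 0 = 1)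
    (h1 : h 1 = 3) (a : ℕ) (ha : a + 1 ≤ j / 2) :
    (h (a + 1) = h a + (a + 2) ∧ 2 * h (a + 1) = (a + 2) * (a + 3)) ∨
      h (a + 1) ≤ h a + (a + 1) := by
  induction a with
  | zero => left; simp [h0, h1]
  | succ a ih =>
    obtain ⟨-, hmon, -, hM⟩ := hSI
    obtain ⟨n, hn, hg, hg'⟩ := hM (a + 1) (by omega) ha
    have hm1 := hmon (a + 1) (by omega) (by omega)
    simp only [Nat.add_eq_zero_iff, one_ne_zero, and_false, if_false,
      Nat.add_sub_cancel] at hg hg' hm1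
    have ih' := ih (by omega)
    have hgr := macaulay_growth_of_le_succ (a + 1) (by omega) n hn (by omega)
    rw [← hg] at hgr
    by_cases hle : h (a + 1 + 1) ≤ h (a + 1) + (a + 1 + 1)
    · exact Or.inr hle
    · left
      have e : h (a + 1 + 1) = h (a + 1) + (a + 1 + 2) := by omega
      refine ⟨e, ?_⟩
      have e2 : 2 * h (a + 1) = (a + 2) * (a + 3) := by
        rcases ih' with h | h
        · exact h.2
        · omega
      rw [e]
      linarith

/-- An SI sequence starting `1, 3` is log-concave in degrees at most the middle. -/
theorem IsSISeq.log_concave_of_le_half {j : ℕ} {h : ℕ → ℕ} (hSI : IsSISeq h j) (h0 : h 0 = 1)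
    (h1 : h 1 = 3) (i : ℕ) (hi : i + 1 ≤ j / 2) :
    h i * h (i + 2) ≤ h (i + 1) * h (i + 1) := by
  have hm1 := hSI.2.1 (i + 1) (by omega) hi
  simp only [Nat.add_sub_cancel] at hm1
  rcases Nat.lt_or_ge (j / 2) (i + 2) with hlt | hge
  · have hsym := hSI.1 (i + 2) (by omega)
    have hle : h (i + 2) ≤ h (i + 1) := by
      rcases (by omega : j - (i + 2) = i ∨ j - (i + 2) = i + 1) with hj | hj
      · rw [hsym, hj]; exact hm1
      · rw [hsym, hj]
    exact Nat.mul_le_mul hm1 hle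
  · have hd := hSI.diff_maximal_or_le h0 h1 i hi
    obtain ⟨n, hn, hg, hg'⟩ := hSI.2.2.2 (i + 1) (by omega) hge
    simp only [Nat.add_eq_zero_iff, one_ne_zero, and_false, if_false,
      Nat.add_sub_cancel] at hg hg'
    have hgr := macaulay_growth_of_le_succ (i + 1) (by omega) n hn (by omega)
    rw [← hg] at hgr
    rcases hgr with hgr | ⟨heq, hgr⟩
    · obtain ⟨d, hd⟩ := Nat.exists_eq_add_of_le hm1
      have hb : h (i + 2) ≤ h i + d + d := by
        have : h (i + 1 + 1) = h (i + 2) := rfl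
        omega
      rw [hd]
      nlinarith [Nat.mul_le_mul_left (h i) hb]
    · have hx : 2 * h (i + 1) = (i + 2) * (i + 3) := by
        rcases hd with hd | hd
        · exact hd.2
        · omega
      have hy : 2 * h i = (i + 1) * (i + 2) := by
        have : h (i + 1) = h i + (i + 2) := by omega
        nlinarith
      have hz : 2 * h (i + 2) ≤ (i + 3) * (i + 4) := by
        have : h (i + 2) ≤ h (i + 1) + (i + 3) := by
          have : h (i + 1 + 1) = h (i + 2) := rfl
          omega
        nlinarith
      have key : (2 * h i) * (2 * h (i + 2)) ≤ (2 * h (i + 1)) * (2 * h (i + 1)) := by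
        rw [hx, hy]
        refine (Nat.mul_le_mul_left _ hz).trans ?_
        have : (i + 1) * (i + 4) ≤ (i + 2) * (i + 3) := by nlinarith
        calc (i + 1) * (i + 2) * ((i + 3) * (i + 4))
            = (i + 2) * (i + 3) * ((i + 1) * (i + 4)) := by ring
          _ ≤ _ := Nat.mul_le_mul_left _ this
      nlinarith

/-- Every SI sequence with `h 0 = 1` and `h 1 = 3` (equivalently, by Buchsbaum–Eisenbud,
every codimension three Gorenstein sequence) is log-concave. -/
theorem si_sequence_three_variables_log_concave
    (j : ℕ) (h : ℕ → ℕ) (hSI : IsSISeq h j) (h0 : h 0 = 1) (h1 : h 1 = 3) :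
    ∀ i : ℕ, 1 ≤ i → i + 1 ≤ j → h (i - 1) * h (i + 1) ≤ h i * h i := by
  intro i hi hij
  rcases Nat.lt_or_ge (j / 2) i with hlt | hge
  · have hlc := hSI.log_concave_of_le_half h0 h1 (j - i - 1) (by omega)
    rw [hSI.1 (i - 1) (by omega), hSI.1 (i + 1) hij, hSI.1 i (by omega), mul_comm]
    rwa [show j - i - 1 + 2 = j - (i - 1) by omega, show j - i - 1 + 1 = j - i by omega,
      show j - i - 1 = j - (i + 1) by omega] at hlc
  · obtain ⟨k, rfl⟩ : ∃ k, i = k + 1 := ⟨i - 1, by omega⟩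
    exact hSI.log_concave_of_le_half h0 h1 k hge
end

section
/- Let j ≥ 2, set j' = ⌊j/2⌋, and let H = (h_0, …, h_j) be a sequence of nonnegative integers with h_i = h_{j−i} for all 0 ≤ i ≤ j. Suppose there exists d with 1 ≤ d ≤ j' such that, writing Δ_i = h_i − h_{i−1} (with h_{−1} = 0), one has Δ_i = i + 1 for 0 ≤ i ≤ d−1, and d ≥ Δ_d ≥ Δ_{d+1} ≥ ⋯ ≥ Δ_{j'} ≥ 0. Then H is log-concave: h_{i−1}·h_{i+1} ≤ h_i² for all 1 ≤ i ≤ j−1. -/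
/-- If the second difference at `b` of nonnegative integers `a ≤ b`, `c` is nonpositive, then
`a * c ≤ b * b`. -/
theorem mul_le_mul_self_of_sub_le_sub {a b c : ℕ} (hcb : (c : ℤ) - b ≤ b - a) :
    a * c ≤ b * b := by
  zify
  have ha : (0 : ℤ) ≤ a := a.cast_nonneg
  nlinarith [mul_le_mul_of_nonneg_left hcb ha, sq_nonneg ((b : ℤ) - a)]

/-- A sequence with first difference `(1, 2, …, d)` consists of triangular numbers. -/
theorem two_mul_eq_of_sub_eq_succ {h : ℕ → ℤ} {n : ℕ} (h_zero : h 0 = 1)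
    (h_sub : ∀ i < n, h (i + 1) - h i = i + 2) :
    ∀ i ≤ n, 2 * h i = (i + 1) * (i + 2) := by
  intro i
  induction i with
  | zero => intro _; simp [h_zero]
  | succ k ih =>
    intro hk
    have h_prev := ih (by omega)
    have h_step := h_sub k (by omega)
    push_cast
    linear_combination h_prev + 2 * h_step

/-- Log-concavity of a symmetric sequence need only be checked on its first half. -/
theorem log_concave_of_symmetric {j : ℕ} {h : ℕ → ℕ} (hsym : ∀ i ≤ j, h i = h (j - i))
    (h_half : ∀ i, 1 ≤ i → i ≤ j / 2 → h (i - 1) * h (i + 1) ≤ h i * h i) :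
    ∀ i, 1 ≤ i → i + 1 ≤ j → h (i - 1) * h (i + 1) ≤ h i * h i := by
  intro i hi hij
  rcases le_or_gt i (j / 2) with hle | hgt
  · exact h_half i hi hle
  · rw [hsym (i - 1) (by omega), hsym (i + 1) hij, hsym i (by omega), mul_comm,
      show j - (i - 1) = j - i + 1 by omega, show j - (i + 1) = j - i - 1 by omega]
    exact h_half (j - i) (by omega) (by omega)

/-- The combinatorial core of the log-concavity of codimension three Gorenstein
sequences: a symmetric sequence whose first difference has the form
`(1, 2, …, d, Δ_d, …, Δ_{j'})` with `d ≥ Δ_d ≥ Δ_{d+1} ≥ ⋯ ≥ Δ_{j'} ≥ 0`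
(where `j' = ⌊j/2⌋`) is log-concave. -/
theorem symmetric_diff_nonincreasing_log_concave
    (j : ℕ) (hj : 2 ≤ j) (h : ℕ → ℕ)
    (hsym : ∀ i ≤ j, h i = h (j - i))
    (d : ℕ) (hd1 : 1 ≤ d) (hd2 : d ≤ j / 2)
    (Δ : ℕ → ℤ)
    (hΔ : ∀ i : ℕ, Δ i = (h i : ℤ) - (if i = 0 then 0 else (h (i - 1) : ℤ)))
    (hinit : ∀ i ≤ d - 1, Δ i = (i : ℤ) + 1)
    (hdtop : Δ d ≤ (d : ℤ))
    (hmono : ∀ i : ℕ, d ≤ i → i + 1 ≤ j / 2 → Δ (i + 1) ≤ Δ i)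
    (hnonneg : ∀ i ≤ j / 2, 0 ≤ Δ i) :
    ∀ i : ℕ, 1 ≤ i → i + 1 ≤ j → h (i - 1) * h (i + 1) ≤ h i * h i := by
  have h_diff (i : ℕ) : Δ (i + 1) = (h (i + 1) : ℤ) - h i := by simp [hΔ]
  have h_tri : ∀ i ≤ d - 1, 2 * (h i : ℤ) = (i + 1) * (i + 2) := by
    refine two_mul_eq_of_sub_eq_succ (h := fun i ↦ (h i : ℤ)) ?_ fun i hi ↦ ?_
    · simpa [hΔ] using hinit 0 (Nat.zero_le _)
    · rw [← h_diff, hinit (i + 1) (by omega)]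
      push_cast
      ring
  refine log_concave_of_symmetric hsym fun i hi hij ↦ ?_
  obtain ⟨k, rfl⟩ : ∃ k, i = k + 1 := ⟨i - 1, by omega⟩
  rw [Nat.add_sub_cancel]
  have h_left := h_diff k
  have h_right := h_diff (k + 1)
  have h_left_nonneg := hnonneg (k + 1) hij
  rcases Nat.lt_or_ge (j / 2) (k + 2) with h_mid | h_lt
  · have h_le : h (k + 2) ≤ h (k + 1) := by
      rw [hsym (k + 2) (by omega)]
      obtain h_eq | h_eq : j - (k + 2) = k ∨ j - (k + 2) = k + 1 := by omega
      · rw [h_eq]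
        omega
      · rw [h_eq]
    exact Nat.mul_le_mul (by omega) h_le
  · rcases Nat.lt_or_ge (k + 2) d with h_init | h_ge
    · have h0 := h_tri k (by omega)
      have h1 := h_tri (k + 1) (by omega)
      have h2 := h_tri (k + 2) (by omega)
      push_cast at h1 h2
      have h_four : 4 * ((h k : ℤ) * h (k + 2)) ≤ 4 * ((h (k + 1) : ℤ) * h (k + 1)) := by
        calc 4 * ((h k : ℤ) * h (k + 2)) = (2 * h k) * (2 * h (k + 2)) := by ring
          _ ≤ (2 * h (k + 1)) * (2 * h (k + 1)) := by
            rw [h0, h1, h2]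
            have hk : (0 : ℤ) ≤ k := k.cast_nonneg
            have : (0 : ℤ) ≤ (k + 2) * (k + 3) := by positivity
            nlinarith
          _ = 4 * ((h (k + 1) : ℤ) * h (k + 1)) := by ring
      zify
      exact le_of_mul_le_mul_left h_four (by norm_num)
    · refine mul_le_mul_self_of_sub_le_sub ?_
      rw [← h_diff, ← h_diff]
      rcases h_ge.eq_or_lt with rfl | h_gt
      · rw [hinit (k + 1) (by omega)]
        push_cast at hdtop ⊢
        linarith
      · exact hmono (k + 1) (by omega) h_lt
end

section
/- Let F be a field, R = F[x,y], and let I ⊆ R be a homogeneous ideal. Let I_p = I ∩ R_p denote the degree-p homogeneous component of I, an F-subspace of the (p+1)-dimensional space R_p of degree-p forms. If I_p ≠ 0, then dim_F I_{p+1} ≥ dim_F I_p + 1. -/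
namespace MvPolynomial

/-- A nonzero space of polynomials of bounded degree is not carried by multiplication by one
variable into its multiple by another variable. -/
theorem exists_X_mul_notMem_map_mulLeft {σ F : Type*} [Field F] {i j : σ} (hij : j ≠ i) {p : ℕ}
    {V : Submodule F (MvPolynomial σ F)} (hV : ∀ f ∈ V, f.totalDegree ≤ p) (hne : V ≠ ⊥) :
    ∃ f ∈ V, X j * f ∉ V.map (LinearMap.mulLeft F (X i)) := by
  by_contra! h
  have key : ∀ n : ℕ, ∃ f ∈ V, f ≠ 0 ∧ n ≤ f.degreeOf j := by
    intro n
    induction n with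
    | zero =>
      obtain ⟨f, hf, hf0⟩ := V.ne_bot_iff.mp hne
      exact ⟨f, hf, hf0, Nat.zero_le _⟩
    | succ n ih =>
      obtain ⟨f, hf, hf0, hn⟩ := ih
      obtain ⟨g, hg, hgf⟩ := h f hf
      rw [LinearMap.mulLeft_apply, mul_comm, mul_comm (X j)] at hgf
      have hdeg : g.degreeOf j = f.degreeOf j + 1 := by
        rw [← degreeOf_mul_X_of_ne g hij, hgf, degreeOf_mul_X_eq_degreeOf_add_one_iff]
        exact hf0
      refine ⟨g, hg, ?_, by omega⟩
      rintro rfl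
      simp at hdeg
  obtain ⟨f, hf, -, hdeg⟩ := key (p + 1)
  have := (degreeOf_le_totalDegree f j).trans (hV f hf)
  omega

theorem homogeneousSubmodule_le_restrictTotalDegree (σ R : Type*) [CommSemiring R] (n : ℕ) :
    homogeneousSubmodule σ R n ≤ restrictTotalDegree σ R n := fun f hf ↦
  (mem_restrictTotalDegree σ n f).mpr (IsHomogeneous.totalDegree_le hf)

end MvPolynomial

/-- For a homogeneous ideal `I ⊆ F[x,y]`, if the degree-`p` component
`I_p = I ∩ R_p` is nonzero, then `dim_F I_{p+1} ≥ dim_F I_p + 1`. -/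
theorem dim_homogeneous_component_strict_growth
    (F : Type*) [Field F] (I : Ideal (MvPolynomial (Fin 2) F))
    (hhom : ∀ f ∈ I, ∀ n : ℕ, MvPolynomial.homogeneousComponent n f ∈ I)
    (p : ℕ)
    (hne : (Submodule.restrictScalars F I ⊓
        MvPolynomial.homogeneousSubmodule (Fin 2) F p) ≠ ⊥) :
    Module.finrank F
        (Submodule.restrictScalars F I ⊓
          MvPolynomial.homogeneousSubmodule (Fin 2) F p : Submodule F (MvPolynomial (Fin 2) F))
      + 1 ≤
    Module.finrank F
        (Submodule.restrictScalars F I ⊓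
          MvPolynomial.homogeneousSubmodule (Fin 2) F (p + 1) :
            Submodule F (MvPolynomial (Fin 2) F)) := by
  set V := Submodule.restrictScalars F I ⊓ MvPolynomial.homogeneousSubmodule (Fin 2) F p
  set W := Submodule.restrictScalars F I ⊓ MvPolynomial.homogeneousSubmodule (Fin 2) F (p + 1)
  have : Module.Finite F W := Submodule.finiteDimensional_of_le <|
    inf_le_right.trans (MvPolynomial.homogeneousSubmodule_le_restrictTotalDegree (Fin 2) F (p + 1))
  have hX (i : Fin 2) (f : MvPolynomial (Fin 2) F) (hf : f ∈ V) : MvPolynomial.X i * f ∈ W := by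
    refine ⟨I.mul_mem_left _ hf.1, ?_⟩
    rw [add_comm]
    exact (MvPolynomial.isHomogeneous_X F i).mul hf.2
  obtain ⟨f, hf, hfV⟩ := MvPolynomial.exists_X_mul_notMem_map_mulLeft (V := V)
    (zero_ne_one' (Fin 2)).symm
    (fun f hf ↦ MvPolynomial.IsHomogeneous.totalDegree_le hf.2) hne
  have hlt : V.map (LinearMap.mulLeft F (MvPolynomial.X 0)) < W :=
    SetLike.lt_iff_le_and_exists.mpr
      ⟨Submodule.map_le_iff_le_comap.mpr (hX 0), _, hX 1 f hf, hfV⟩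
  have hinj : Function.Injective (LinearMap.mulLeft F (MvPolynomial.X (R := F) (0 : Fin 2))) :=
    mul_right_injective₀ (MvPolynomial.X_ne_zero 0)
  rw [(Submodule.equivMapOfInjective _ hinj V).finrank_eq]
  exact Submodule.finrank_lt_finrank_of_lt hlt
end

section
/- Let F be a field, R = F[x,y], and let I ⊆ R be a homogeneous ideal with degree-p component I_p = I ∩ R_p. Define the Hilbert function of B = R/I by H(B)_p = dim_F R_p − dim_F I_p = (p+1) − dim_F I_p. If I_p ≠ 0, then H(B)_p ≥ H(B)_{p+1}. In other words, the Hilbert function of a standard graded Artinian (or any graded) quotient of F[x,y] is non-increasing from the initial degree of its defining ideal onward. -/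
open MvPolynomial in
/-- A nonzero space `V` of polynomials of degree at most `p` is not carried into `x V` by
multiplication by `y`. -/
theorem exists_X_one_mul_notMem_map_X_zero {F : Type*} [Field F] {p : ℕ}
    (V : Submodule F (MvPolynomial (Fin 2) F)) (hdeg : ∀ v ∈ V, v.totalDegree ≤ p)
    (hne : V ≠ ⊥) :
    ∃ v ∈ V, X 1 * v ∉ V.map (LinearMap.mulLeft F (X 0)) := by
  by_contra! h
  have hdvd : ∀ n : ℕ, ∀ v ∈ V, (X 0 : MvPolynomial (Fin 2) F) ^ n ∣ v := by
    intro n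
    induction n with
    | zero => simp
    | succ n ih =>
      intro v hv
      obtain ⟨w, hw, hwv⟩ := h v hv
      have hnd : ¬ (X 0 : MvPolynomial (Fin 2) F) ∣ X 1 := by
        rw [X_dvd_X]
        decide
      refine X_prime.pow_dvd_of_dvd_mul_left _ hnd ?_
      rw [← hwv, LinearMap.mulLeft_apply, pow_succ']
      exact mul_dvd_mul_left _ (ih w hw)
  obtain ⟨v, hv, hv0⟩ := V.ne_bot_iff.mp hne
  obtain ⟨w, hw⟩ := hdvd (p + 1) v hv
  have hw0 : w ≠ 0 := by
    rintro rfl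
    exact hv0 (by simpa using hw)
  have hle := hdeg v hv
  rw [hw, totalDegree_mul_of_isDomain (pow_ne_zero _ (X_ne_zero 0)) hw0,
    totalDegree_X_pow] at hle
  omega

open MvPolynomial in
/-- If `W` contains `x V` and `y V`, where `V` is a nonzero space of polynomials of degree at
most `p`, then `dim V < dim W`. -/
theorem finrank_lt_finrank_of_X_mul_mem {F : Type*} [Field F] {p : ℕ}
    (V W : Submodule F (MvPolynomial (Fin 2) F)) [Module.Finite F W]
    (hdeg : ∀ v ∈ V, v.totalDegree ≤ p) (hne : V ≠ ⊥) (hmul : ∀ i, ∀ v ∈ V, X i * v ∈ W) :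
    Module.finrank F V < Module.finrank F W := by
  have hinj : Function.Injective (LinearMap.mulLeft F (X 0 : MvPolynomial (Fin 2) F)) :=
    mul_right_injective₀ (X_ne_zero 0)
  rw [(Submodule.equivMapOfInjective _ hinj V).finrank_eq]
  obtain ⟨v, hv, hvn⟩ := exists_X_one_mul_notMem_map_X_zero V hdeg hne
  refine Submodule.finrank_lt_finrank_of_lt (SetLike.lt_iff_le_and_exists.mpr
    ⟨?_, X 1 * v, hmul 1 v hv, hvn⟩)
  rintro _ ⟨u, hu, rfl⟩
  exact hmul 0 u hu


/-- The Hilbert function of a graded quotient `B = F[x,y]/I` is non-increasing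
from the initial degree of `I` onward: if `I_p ≠ 0` then `H(B)_p ≥ H(B)_{p+1}`,
where `H(B)_q = (q + 1) - dim_F I_q`. -/
theorem codim_two_hilbert_function_nonincreasing
    (F : Type*) [Field F] (I : Ideal (MvPolynomial (Fin 2) F))
    (hhom : ∀ f ∈ I, ∀ n : ℕ, MvPolynomial.homogeneousComponent n f ∈ I)
    (H : ℕ → ℕ)
    (hH : ∀ q : ℕ, H q = (q + 1) -
      Module.finrank F
        (Submodule.restrictScalars F I ⊓
          MvPolynomial.homogeneousSubmodule (Fin 2) F q : Submodule F (MvPolynomial (Fin 2) F)))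
    (p : ℕ)
    (hne : (Submodule.restrictScalars F I ⊓
        MvPolynomial.homogeneousSubmodule (Fin 2) F p) ≠ ⊥) :
    H (p + 1) ≤ H p := by
  have hfin : Module.Finite F (MvPolynomial.homogeneousSubmodule (Fin 2) F (p + 1)) :=
    Module.Finite.iff_fg.mpr (MvPolynomial.homogeneousSubmodule_fg _ _ _)
  have hfinI : Module.Finite F (Submodule.restrictScalars F I ⊓
      MvPolynomial.homogeneousSubmodule (Fin 2) F (p + 1) :
        Submodule F (MvPolynomial (Fin 2) F)) :=
    Submodule.finiteDimensional_of_le inf_le_right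
  have hlt := finrank_lt_finrank_of_X_mul_mem (p := p) (Submodule.restrictScalars F I ⊓
      MvPolynomial.homogeneousSubmodule (Fin 2) F p) (Submodule.restrictScalars F I ⊓
      MvPolynomial.homogeneousSubmodule (Fin 2) F (p + 1))
    (fun v hv => MvPolynomial.IsHomogeneous.totalDegree_le hv.2) hne
    (fun i v hv => ⟨I.mul_mem_left _ hv.1, by
      have := (MvPolynomial.isHomogeneous_X F i).mul hv.2
      rwa [add_comm] at this⟩)
  rw [hH, hH]
  omega
end

section
/- The symmetric sequence H = (1, 4, 10, 20, 35, 56, 84, 92, 101, 92, 84, 56, 35, 20, 10, 4, 1) of socle degree 16 is an SI sequence (its first difference restricted to degrees 0 through 8, namely (1, 3, 6, 10, 15, 21, 28, 8, 9), is a Macaulay sequence), its entries sum to 705, and it is not log-concave in degree 7: h_6 · h_8 = 84 · 101 = 8484 > 8464 = 92² = h_7². -/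
/-- The sequence `H = (1,4,10,20,35,56,84,92,101,92,84,56,35,20,10,4,1)` of socle
degree 16 is an SI sequence, its entries sum to 705, and it is not log-concave in
degree 7: `h 6 * h 8 = 8484 > 8464 = (h 7)²`. -/
theorem codim_four_si_sequence_not_log_concave_socle_degree_16
    (h : ℕ → ℕ)
    (hh : ∀ i : ℕ, h i =
      [1, 4, 10, 20, 35, 56, 84, 92, 101, 92, 84, 56, 35, 20, 10, 4, 1].getD i 0) :
    IsSISeq h 16 ∧ (∑ i ∈ Finset.range 17, h i) = 705 ∧
      h 6 * h 8 > h 7 * h 7 := by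
  obtain rfl : h = _ := funext hh
  refine ⟨⟨by decide, ?_, rfl, ?_⟩, by decide, by decide⟩
  · intro i h1 h2
    interval_cases i <;> decide
  · intro a h1 h2
    refine ⟨fun i => if i < a then i - 1 else if a = 7 then 8 else a + 2, ?_, ?_⟩
    · intro i hi hia
      grind
    · have h3 : a ≤ 7 := by omega
      clear h2 hh
      interval_cases a <;> decide
end

section
/- Define the symmetric sequence H = (h_0, …, h_24) of socle degree 24 by h_i = C(i+3, 3) for 0 ≤ i ≤ 10, h_11 = 309, h_12 = 334, and h_i = h_{24−i} for i > 12 (so h_10, h_11, h_12, h_13, h_14 = 286, 309, 334, 309, 286). Then H is an SI sequence (its first difference restricted to degrees 0 through 12, namely (1, 3, 6, 10, 15, 21, 28, 36, 45, 55, 66, 23, 25), is a Macaulay sequence), its entries sum to 2954, and it is not log-concave in degree 11: h_10 · h_12 = 286 · 334 = 95524 > 95481 = 309² = h_11². -/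
/-- The symmetric sequence of socle degree 24 with `h i = C(i+3,3)` for `i ≤ 10`,
`h 11 = 309`, `h 12 = 334` (key entries `286, 309, 334, 309, 286` in degrees 10–14)
is an SI sequence, its entries sum to 2954, and it is not log-concave in degree 11:
`h 10 * h 12 = 95524 > 95481 = (h 11)²`. -/
theorem codim_four_si_sequence_not_log_concave_socle_degree_24
    (h : ℕ → ℕ)
    (hinit : ∀ i ≤ 10, h i = Nat.choose (i + 3) 3)
    (h11 : h 11 = 309) (h12 : h 12 = 334)
    (hsym : ∀ i : ℕ, 12 < i → i ≤ 24 → h i = h (24 - i)) :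
    IsSISeq h 24 ∧ (∑ i ∈ Finset.range 25, h i) = 2954 ∧
      h 10 * h 12 > h 11 * h 11 := by
  have diff : ∀ a, 1 ≤ a → a ≤ 10 → h a - h (a - 1) = Nat.choose (a + 2) 2 := by
    intro a ha ha'
    rw [hinit a ha', hinit (a - 1) (by omega)]
    interval_cases a <;> rfl
  refine ⟨⟨?_, ?_, ?_, ?_⟩, ?_, ?_⟩
  · intro i hi
    rcases lt_trichotomy i 12 with hlt | rfl | hgt
    · rw [hsym (24 - i) (by omega) (by omega)]
      congr 1
      omega
    · rfl
    · exact hsym i hgt hi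
  · intro i hi hi'
    rcases (show i ≤ 10 ∨ i = 11 ∨ i = 12 by omega) with h10 | rfl | rfl
    · rw [hinit i h10, hinit (i - 1) (by omega)]
      exact Nat.choose_le_choose 3 (by omega)
    · norm_num [h11, hinit 10 le_rfl, Nat.choose]
    · norm_num [h11, h12]
  · simp [hinit 0 (Nat.zero_le _)]
  · intro a ha ha'
    rcases (show a ≤ 10 ∨ a = 11 by omega) with h10 | rfl
    · refine ⟨fun i => if i < a then i - 1 else a + 2, ?_, ?_, ?_⟩
      · intro i _ _
        dsimp only
        split_ifs <;> omega
      · simp only [if_neg (show a ≠ 0 by omega), diff a ha h10]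
        interval_cases a <;> decide
      · rcases (show a ≤ 9 ∨ a = 10 by omega) with h9 | rfl
        · simp only [if_neg (show a + 1 ≠ 0 by omega), diff (a + 1) (by omega) (by omega)]
          interval_cases a <;> decide
        · simp only [hinit 10 le_rfl, h11, Nat.reduceAdd, Nat.reduceSub, OfNat.ofNat_ne_zero, if_false]
          decide
    · refine ⟨fun i => if i < 10 then i - 1 else i + 1, ?_, ?_, ?_⟩
      · intro i _ _
        dsimp only
        split_ifs <;> omega
      · simp only [hinit 10 le_rfl, h11, Nat.reduceSub, OfNat.ofNat_ne_zero, if_false]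
        decide
      · simp only [h12, h11, Nat.reduceAdd, Nat.reduceSub, OfNat.ofNat_ne_zero, if_false]
        decide
  · simp only [Finset.sum_range_succ, Finset.sum_range_zero]
    norm_num [hsym, h11, h12, hinit, Nat.choose]
  · rw [h11, h12, hinit 10 le_rfl]
    decide
end

section
/- Let k ≥ 10 and set s_k = C(k+3, 3). Then 2·s_k > (2k+3)², and the symmetric sequence H of socle degree 2k+4 defined by h_i = C(i+3, 3) for 0 ≤ i ≤ k, h_{k+1} = s_k + 2k + 3, h_{k+2} = s_k + 4k + 8, and h_i = h_{2k+4−i} for i > k+2, is an SI sequence (its first difference on degrees 0 through k+2, namely (1, 3, 6, …, C(k+2, 2), 2k+3, 2k+5), is a Macaulay sequence) that is not log-concave in degree k+1 and whose entries sum to 2·C(k+4, 4) + 3·s_k + 8k + 14. -/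
/-- The Macaulay expansion `C(a+2, 2) = C(a+2, a)` in degree `a ≥ 1`, with its growth bound. -/
theorem exists_macaulay_expansion_choose_two (a b : ℕ) (ha : 1 ≤ a)
    (hb : b ≤ Nat.choose (a + 3) 2) :
    ∃ n : ℕ → ℕ, (∀ i : ℕ, 1 ≤ i → i < a → n i < n (i + 1)) ∧
      Nat.choose (a + 2) 2 = ∑ i ∈ Finset.Icc 1 a, Nat.choose (n i) i ∧
      b ≤ ∑ i ∈ Finset.Icc 1 a, Nat.choose (n i + 1) (i + 1) := by
  have ha' : a ∈ Finset.Icc 1 a := Finset.mem_Icc.mpr ⟨ha, le_rfl⟩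
  refine ⟨fun i => if i = a then a + 2 else i - 1, fun i _ _ => ?_, ?_, ?_⟩
  · dsimp only
    split_ifs <;> omega
  · rw [Finset.sum_eq_single_of_mem a ha']
    · simpa using (Nat.choose_symm_add (a := a) (b := 2)).symm
    · intro i hi hia
      have := (Finset.mem_Icc.mp hi).1
      simp only [hia, if_false]
      exact Nat.choose_eq_zero_of_lt (by omega)
  · refine le_trans (hb.trans ?_)
      (Finset.single_le_sum (fun _ _ => Nat.zero_le _) ha')
    have := Nat.choose_symm_add (a := a + 1) (b := 2)
    simp only [if_true]
    exact this.ge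

/-- The Macaulay expansion `2k+3 = C(k+2, k+1) + C(k+1, k)` in degree `k+1`, with its
growth bound `2k+5`. -/
theorem exists_macaulay_expansion_two_mul_add_three (k : ℕ) (hk : 1 ≤ k) :
    ∃ n : ℕ → ℕ, (∀ i : ℕ, 1 ≤ i → i < k + 1 → n i < n (i + 1)) ∧
      2 * k + 3 = ∑ i ∈ Finset.Icc 1 (k + 1), Nat.choose (n i) i ∧
      2 * k + 5 ≤ ∑ i ∈ Finset.Icc 1 (k + 1), Nat.choose (n i + 1) (i + 1) := by
  obtain ⟨m, rfl⟩ : ∃ m, k = m + 1 := ⟨k - 1, by omega⟩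
  have hlow : ∀ i ∈ Finset.Icc 1 m, ¬ m + 1 ≤ i := fun i hi => by
    have := (Finset.mem_Icc.mp hi).2
    omega
  refine ⟨fun i => if m + 1 ≤ i then i + 1 else i - 1, fun i _ _ => ?_, ?_, ?_⟩
  · dsimp only
    split_ifs <;> omega
  · rw [Finset.sum_Icc_succ_top (by omega), Finset.sum_Icc_succ_top (by omega),
      Finset.sum_eq_zero]
    · simp
      omega
    · intro i hi
      have := (Finset.mem_Icc.mp hi).1
      simp only [hlow i hi, if_false]
      exact Nat.choose_eq_zero_of_lt (by omega)
  · rw [Finset.sum_Icc_succ_top (by omega), Finset.sum_Icc_succ_top (by omega)]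
    simp
    omega

theorem six_mul_choose_add_three (k : ℕ) :
    6 * Nat.choose (k + 3) 3 = (k + 1) * (k + 2) * (k + 3) := by
  have := Nat.ascFactorial_eq_factorial_mul_choose k 3
  simp [Nat.ascFactorial, Nat.factorial] at this
  linarith

theorem sum_range_choose_add_three (k : ℕ) :
    ∑ i ∈ Finset.range (k + 1), Nat.choose (i + 3) 3 = Nat.choose (k + 4) 4 :=
  Nat.sum_range_add_choose k 3

/-- For `k ≥ 10` one has `2·s_k > (2k+3)²` where `s_k = C(k+3,3)`, and the symmetric
sequence of socle degree `2k+4` with `h i = C(i+3,3)` for `i ≤ k`,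
`h (k+1) = s_k + 2k + 3`, `h (k+2) = s_k + 4k + 8` is an SI sequence that is not
log-concave in degree `k+1`, of total length `2·C(k+4,4) + 3·s_k + 8k + 14`. -/
theorem general_delta_two_family_not_log_concave
    (k : ℕ) (hk : 10 ≤ k) (h : ℕ → ℕ)
    (hinit : ∀ i ≤ k, h i = Nat.choose (i + 3) 3)
    (h1 : h (k + 1) = Nat.choose (k + 3) 3 + 2 * k + 3)
    (h2 : h (k + 2) = Nat.choose (k + 3) 3 + 4 * k + 8)
    (hsym : ∀ i : ℕ, k + 2 < i → i ≤ 2 * k + 4 → h i = h (2 * k + 4 - i)) :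
    2 * Nat.choose (k + 3) 3 > (2 * k + 3) ^ 2 ∧
    IsSISeq h (2 * k + 4) ∧
    h k * h (k + 2) > h (k + 1) * h (k + 1) ∧
    (∑ i ∈ Finset.range (2 * k + 5), h i) =
      2 * Nat.choose (k + 4) 4 + 3 * Nat.choose (k + 3) 3 + 8 * k + 14 := by
  have hgt : 2 * Nat.choose (k + 3) 3 > (2 * k + 3) ^ 2 := by
    have h6 := six_mul_choose_add_three k
    obtain ⟨m, rfl⟩ := Nat.exists_eq_add_of_le hk
    ring_nf at h6 ⊢
    nlinarith [Nat.zero_le (m ^ 3), Nat.zero_le (m ^ 2)]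
  have hsucc : ∀ b, Nat.choose (b + 1 + 3) 3 = Nat.choose (b + 1 + 2) 2 + Nat.choose (b + 3) 3 :=
    fun b => Nat.choose_succ_succ (b + 3) 2
  have hdiv : (2 * k + 4) / 2 = k + 2 := by omega
  have hsymm : ∀ i ≤ 2 * k + 4, h i = h (2 * k + 4 - i) := by
    intro i hi
    rcases lt_trichotomy i (k + 2) with hlt | rfl | hlt
    · rw [hsym (2 * k + 4 - i) (by omega) (by omega)]
      congr 1
      omega
    · congr 1
      omega
    · exact hsym i hlt hi
  have hdiff : ∀ a, 1 ≤ a → a ≤ k → h a = Nat.choose (a + 2) 2 + h (a - 1) := by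
    intro a ha hak
    obtain ⟨b, rfl⟩ := Nat.exists_eq_add_of_le' ha
    rw [hinit _ hak, Nat.add_sub_cancel, hinit b (by omega), hsucc]
  have hk0 := hinit k le_rfl
  refine ⟨hgt, ⟨hsymm, ?_, ?_⟩, ?_, ?_⟩
  · rw [hdiv]
    intro i hi hik
    rcases (by omega : i ≤ k ∨ i = k + 1 ∨ i = k + 2) with hle | rfl | rfl
    · rw [hdiff i hi hle]
      omega
    · rw [Nat.add_sub_cancel]
      omega
    · rw [show k + 2 - 1 = k + 1 by omega]
      omega
  · rw [hdiv]
    refine ⟨by simp [hinit 0 (Nat.zero_le k)], fun a ha hak => ?_⟩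
    have hg : ∀ a, 1 ≤ a → a ≤ k → h a - h (a - 1) = Nat.choose (a + 2) 2 := fun a ha hak => by
      rw [hdiff a ha hak, Nat.add_sub_cancel]
    have hg1 : h (k + 1) - h k = 2 * k + 3 := by omega
    simp only [Nat.add_sub_cancel, show a ≠ 0 by omega, Nat.succ_ne_zero, if_false]
    rcases (by omega : a + 1 ≤ k ∨ a = k ∨ a = k + 1) with hle | rfl | rfl
    · rw [hg a ha (by omega)]
      refine exists_macaulay_expansion_choose_two a _ ha (le_of_eq ?_)
      simpa using hg (a + 1) (by omega) hle
    · rw [hg a ha le_rfl, hg1]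
      refine exists_macaulay_expansion_choose_two a _ ha ?_
      have h2 : Nat.choose (a + 3) 2 = a + 2 + (a + 1 + Nat.choose (a + 1) 2) := by
        rw [Nat.choose_succ_succ' (a + 2) 1, Nat.choose_succ_succ' (a + 1) 1]
        simp
      have h3 : 0 < Nat.choose (a + 1) 2 := Nat.choose_pos (by omega)
      omega
    · have hg2 : h (k + 1 + 1) - h (k + 1) = 2 * k + 5 := by
        rw [show k + 1 + 1 = k + 2 by omega]
        omega
      rw [Nat.add_sub_cancel, hg1, hg2]
      exact exists_macaulay_expansion_two_mul_add_three k (by omega)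
  · rw [hk0, h1, h2]
    nlinarith
  · have hhead : ∑ i ∈ Finset.range (k + 1), h i = Nat.choose (k + 4) 4 := by
      rw [← sum_range_choose_add_three]
      exact Finset.sum_congr rfl fun i hi => hinit i (by have := Finset.mem_range.mp hi; omega)
    have htail : ∑ i ∈ Finset.range (k + 2), h (k + 3 + i) = ∑ i ∈ Finset.range (k + 2), h i := by
      rw [← Finset.sum_range_reflect h (k + 2)]
      refine Finset.sum_congr rfl fun i hi => ?_
      have := Finset.mem_range.mp hi
      rw [hsym _ (by omega) (by omega)]
      congr 1
      omega
    rw [show 2 * k + 5 = k + 3 + (k + 2) by omega, Finset.sum_range_add, htail,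
      Finset.sum_range_succ h (k + 2), Finset.sum_range_succ h (k + 1), hhead, h1, h2]
    ring
end

section
/- Let k ≥ 10 and let b be an integer with 2k+3 ≤ b and b² < 2·s_k, where s_k = C(k+3, 3). Then the symmetric sequence H of socle degree 2k+4 with h_i = C(i+3, 3) for 0 ≤ i ≤ k, h_{k+1} = s_k + b, h_{k+2} = s_k + 2b + 2, and h_i = h_{2k+4−i} for i > k+2, is not log-concave in degree k+1 (h_k · h_{k+2} > h_{k+1}²), and its entries sum to 2·C(k+4, 4) + 3·s_k + 4b + 2. -/
/-- The sum of a sequence that is symmetric about `m` on `{0, …, 2m}`. -/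
theorem sum_range_two_mul_add_one_of_symm {M : Type*} [AddCommMonoid M] (f : ℕ → M) (m : ℕ)
    (hf : ∀ i, m < i → i ≤ 2 * m → f i = f (2 * m - i)) :
    ∑ i ∈ Finset.range (2 * m + 1), f i = 2 • (∑ i ∈ Finset.range m, f i) + f m := by
  have upper : ∑ i ∈ Finset.range m, f (m + 1 + i) = ∑ i ∈ Finset.range m, f i := by
    rw [← Finset.sum_range_reflect f m]
    refine Finset.sum_congr rfl fun i hi => ?_
    have hi := Finset.mem_range.mp hi
    rw [hf _ (by lia) (by lia)]
    congr 1
    lia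
  rw [show 2 * m + 1 = m + 1 + m by ring, Finset.sum_range_add, upper, Finset.sum_range_succ,
    two_nsmul, add_right_comm]


/-- For `k ≥ 10` and `2k + 3 ≤ b` with `b² < 2·s_k` (`s_k = C(k+3,3)`), the symmetric
sequence of socle degree `2k+4` with `h i = C(i+3,3)` for `i ≤ k`, `h (k+1) = s_k + b`,
`h (k+2) = s_k + 2b + 2` is not log-concave in degree `k+1`, and its entries sum to
`2·C(k+4,4) + 3·s_k + 4b + 2`. -/
theorem delta_two_family_general_b_not_log_concave
    (k b : ℕ) (hk : 10 ≤ k) (hb1 : 2 * k + 3 ≤ b)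
    (hb2 : b ^ 2 < 2 * Nat.choose (k + 3) 3)
    (h : ℕ → ℕ)
    (hinit : ∀ i ≤ k, h i = Nat.choose (i + 3) 3)
    (h1 : h (k + 1) = Nat.choose (k + 3) 3 + b)
    (h2 : h (k + 2) = Nat.choose (k + 3) 3 + 2 * b + 2)
    (hsym : ∀ i : ℕ, k + 2 < i → i ≤ 2 * k + 4 → h i = h (2 * k + 4 - i)) :
    h k * h (k + 2) > h (k + 1) * h (k + 1) ∧
    (∑ i ∈ Finset.range (2 * k + 5), h i) =
      2 * Nat.choose (k + 4) 4 + 3 * Nat.choose (k + 3) 3 + 4 * b + 2 := by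
  constructor
  · rw [hinit k le_rfl, h1, h2]
    nlinarith
  · have lower : ∑ i ∈ Finset.range (k + 1), h i = Nat.choose (k + 4) 4 := by
      rw [← Nat.sum_range_add_choose k 3]
      exact Finset.sum_congr rfl fun i hi => hinit i (by simpa [Nat.lt_succ_iff] using hi)
    rw [show 2 * k + 5 = 2 * (k + 2) + 1 by ring,
      sum_range_two_mul_add_one_of_symm h (k + 2) hsym, Finset.sum_range_succ, lower, h1, h2,
      smul_eq_mul]
    ring
end

section
/- Let k, b, ℓ be nonnegative integers with s_k = C(k+3, 3), and suppose b·ℓ + ℓ(ℓ+1)/2 < s_k − b². Define the symmetric sequence H'(ℓ) of socle degree j = 2k + 4 + 2ℓ by H'_i = C(i+3, 3) for 0 ≤ i ≤ k, H'_{k+u} = s_k + b·u + u(u−1)/2 for 0 ≤ u ≤ ℓ+2, and H'_i = H'_{j−i} for i > k+ℓ+2. Then H'(ℓ) is not log-concave in each of the ℓ+1 consecutive degrees k+1, k+2, …, k+ℓ+1: for each u with 1 ≤ u ≤ ℓ+1, H'_{k+u−1} · H'_{k+u+1} > (H'_{k+u})². -/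
/-- If `b·ℓ + ℓ(ℓ+1)/2 < s_k − b²` with `s_k = C(k+3,3)`, then the symmetric sequence
`H'(ℓ)` of socle degree `j = 2k + 4 + 2ℓ`, with `H' i = C(i+3,3)` for `i ≤ k`,
`H' (k+u) = s_k + b·u + u(u−1)/2` for `0 ≤ u ≤ ℓ+2`, and `H' i = H' (j−i)` beyond, is
not log-concave in each of the `ℓ+1` consecutive degrees `k+1, …, k+ℓ+1`. -/
theorem extended_sequence_multiple_non_log_concave_degrees
    (k b ℓ : ℕ)
    (hcond : b * ℓ + ℓ * (ℓ + 1) / 2 < Nat.choose (k + 3) 3 - b ^ 2)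
    (H : ℕ → ℕ)
    (hinit : ∀ i ≤ k, H i = Nat.choose (i + 3) 3)
    (hmid : ∀ u ≤ ℓ + 2, H (k + u) = Nat.choose (k + 3) 3 + b * u + u * (u - 1) / 2)
    (hsym : ∀ i : ℕ, k + ℓ + 2 < i → i ≤ 2 * k + 4 + 2 * ℓ →
      H i = H (2 * k + 4 + 2 * ℓ - i)) :
    ∀ u : ℕ, 1 ≤ u → u ≤ ℓ + 1 →
      H (k + u - 1) * H (k + u + 1) > H (k + u) * H (k + u) := by
  intro u hu hul
  obtain ⟨v, rfl⟩ : ∃ v, u = v + 1 := ⟨u - 1, by omega⟩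
  have hv : v ≤ ℓ := by omega
  have h0 := hmid v (by omega)
  have h1 := hmid (v + 1) (by omega)
  have h2 := hmid (v + 2) (by omega)
  have t1 : (v + 1) * (v + 1 - 1) / 2 = v * (v - 1) / 2 + v := Nat.triangle_succ v
  have t2 : (v + 2) * (v + 2 - 1) / 2 = (v + 1) * (v + 1 - 1) / 2 + (v + 1) :=
    Nat.triangle_succ (v + 1)
  have t3 : v * (v + 1) / 2 = v * (v - 1) / 2 + v := by
    rw [← t1, Nat.add_sub_cancel, Nat.mul_comm]
  have hsq : 2 * (v * (v - 1) / 2) + v = v * v := by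
    rw [Nat.mul_div_cancel' (Nat.even_mul_pred_self v).two_dvd]
    cases v with
    | zero => rfl
    | succ n => rw [Nat.add_sub_cancel]; ring
  have hmono : b * v + v * (v + 1) / 2 ≤ b * ℓ + ℓ * (ℓ + 1) / 2 := by gcongr
  have hlt : b * v + (v * (v - 1) / 2 + v) + b ^ 2 < Nat.choose (k + 3) 3 := by omega
  rw [show k + (v + 1) - 1 = k + v by omega, show k + (v + 1) + 1 = k + (v + 2) by omega,
    h0, h1, h2, t2, t1]
  generalize v * (v - 1) / 2 = t at *
  generalize Nat.choose (k + 3) 3 = s at *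
  nlinarith only [hlt, hsq]
end

section
/- Let a ≥ 1 and 1 ≤ δ ≤ a be integers, and suppose h is a positive integer admitting a Macaulay expansion in degree a, h = Σ_{i=1}^a C(n_i, i) with n_a > n_{a−1} > ⋯ > n_1 ≥ 0, in which n_i = i + 1 for every i with a − δ + 1 ≤ i ≤ a (i.e., the top δ terms of the expansion have the maximal-growth form C(i+1, i)). Then h ≥ δ·a − δ(δ−3)/2, equivalently 2h ≥ 2δa − δ² + 3δ. In particular, δ ≥ 2 forces h ≥ 2a + 1 and δ ≥ 3 forces h ≥ 3a. -/
/-- The closed form of an arithmetic progression of `d` consecutive integers, starting at `m + 2`. -/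
theorem two_mul_sum_Ioc_add_one (m d : ℕ) :
    2 * ∑ i ∈ Finset.Ioc m (m + d), (i + 1) = 2 * d * m + d ^ 2 + 3 * d := by
  induction d with
  | zero => simp
  | succ d ih =>
    rw [← add_assoc, Finset.sum_Ioc_succ_top (by omega), mul_add, ih]
    ring

/-- A sum of binomials `C(n i, i)` whose top `d` terms have `n i = i + 1` is at least the sum of
those terms. -/
theorem le_two_mul_sum_choose_of_top_eq_succ (m d : ℕ) (n : ℕ → ℕ)
    (htop : ∀ i, m < i → i ≤ m + d → n i = i + 1) :
    2 * d * m + d ^ 2 + 3 * d ≤ 2 * ∑ i ∈ Finset.Icc 1 (m + d), (n i).choose i := by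
  rw [← two_mul_sum_Ioc_add_one]
  gcongr
  calc ∑ i ∈ Finset.Ioc m (m + d), (i + 1)
      = ∑ i ∈ Finset.Ioc m (m + d), (n i).choose i := by
        refine Finset.sum_congr rfl fun i hi => ?_
        rw [Finset.mem_Ioc] at hi
        rw [htop i hi.1 hi.2, Nat.choose_succ_self_right]
    _ ≤ ∑ i ∈ Finset.Icc 1 (m + d), (n i).choose i := by
        refine Finset.sum_le_sum_of_subset fun i hi => ?_
        simp only [Finset.mem_Ioc, Finset.mem_Icc] at hi ⊢
        omega


/-- If the Macaulay expansion of `h` in degree `a`, `h = Σ_{i=1}^a C(n i, i)` with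
`n a > ⋯ > n 1 ≥ 0`, has its top `δ` terms of maximal-growth form (`n i = i + 1` for
`a − δ + 1 ≤ i ≤ a`), then `h ≥ δ·a − δ(δ−3)/2`, equivalently `2h ≥ 2δa − δ² + 3δ`.
In particular `δ ≥ 2` forces `h ≥ 2a + 1` and `δ ≥ 3` forces `h ≥ 3a`. -/
theorem macaulay_expansion_maximal_growth_lower_bound
    (a δ : ℕ) (ha : 1 ≤ a) (hδ1 : 1 ≤ δ) (hδa : δ ≤ a)
    (h : ℕ) (hpos : 0 < h) (n : ℕ → ℕ)
    (hmono : ∀ i : ℕ, 1 ≤ i → i < a → n i < n (i + 1))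
    (hexp : h = ∑ i ∈ Finset.Icc 1 a, Nat.choose (n i) i)
    (htop : ∀ i : ℕ, a - δ + 1 ≤ i → i ≤ a → n i = i + 1) :
    2 * h ≥ 2 * δ * a - δ ^ 2 + 3 * δ ∧
    (2 ≤ δ → h ≥ 2 * a + 1) ∧
    (3 ≤ δ → h ≥ 3 * a) := by
  have key : ∀ d m, d ≤ δ → a = m + d → 2 * d * m + d ^ 2 + 3 * d ≤ 2 * h := by
    rintro d m hd rfl
    rw [hexp]
    exact le_two_mul_sum_choose_of_top_eq_succ m d n fun i hi => htop i (by omega)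
  refine ⟨?_, fun hδ => ?_, fun hδ => ?_⟩
  · obtain ⟨m, rfl⟩ := Nat.exists_eq_add_of_le' hδa
    have hsub : 2 * δ * (m + δ) - δ ^ 2 = 2 * δ * m + δ ^ 2 :=
      Nat.sub_eq_of_eq_add (by ring)
    rw [hsub]
    exact key δ m le_rfl rfl
  · have := key 2 (a - 2) hδ (by omega)
    omega
  · have := key 3 (a - 3) hδ (by omega)
    omega
end

section
/- Let j ≥ 2 and d ≥ 1 with d ≤ j, and let H = (h_0, …, h_j) be a sequence of nonnegative integers such that h_i = i + 1 for 0 ≤ i ≤ d−1, and such that, setting e_i = h_{i−1} − h_i for d ≤ i ≤ j, one has 0 ≤ e_d ≤ e_{d+1} ≤ ⋯ ≤ e_j ≤ h_j. Then H is log-concave: h_{i−1}·h_{i+1} ≤ h_i² for all 1 ≤ i ≤ j−1. (Since by Macaulay these are exactly the codimension two level sequences, every codimension two level sequence is log-concave.) -/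
/-- Every codimension two level sequence is log-concave: if `h i = i + 1` for
`i ≤ d − 1` and the decrements `e i = h (i−1) − h i` satisfy
`0 ≤ e d ≤ e (d+1) ≤ ⋯ ≤ e j ≤ h j`, then `H` is log-concave. -/
theorem codim_two_level_sequence_log_concave
    (j d : ℕ) (hj : 2 ≤ j) (hd : 1 ≤ d) (hdj : d ≤ j)
    (h : ℕ → ℕ)
    (hinit : ∀ i ≤ d - 1, h i = i + 1)
    (e : ℕ → ℤ)
    (he : ∀ i : ℕ, d ≤ i → i ≤ j → e i = (h (i - 1) : ℤ) - (h i : ℤ))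
    (he0 : 0 ≤ e d)
    (hmono : ∀ i : ℕ, d ≤ i → i + 1 ≤ j → e i ≤ e (i + 1))
    (hej : e j ≤ (h j : ℤ)) :
    ∀ i : ℕ, 1 ≤ i → i + 1 ≤ j → h (i - 1) * h (i + 1) ≤ h i * h i := by
  have he_nonneg : ∀ i : ℕ, d ≤ i → i ≤ j → 0 ≤ e i := by
    intro i hdi
    induction i, hdi using Nat.le_induction with
    | base => exact fun _ => he0
    | succ n hdn ih => exact fun hn => (ih (by omega)).trans (hmono n hdn hn)
  intro i hi hij
  obtain ⟨k, rfl⟩ : ∃ k, i = k + 1 := ⟨i - 1, by omega⟩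
  rw [Nat.add_sub_cancel]
  rcases lt_trichotomy (k + 1 + 1) d with hlt | heq | hgt
  · rw [hinit k (by omega), hinit (k + 1) (by omega), hinit (k + 1 + 1) (by omega)]
    nlinarith
  · have hk := hinit k (by omega)
    have hk' := hinit (k + 1) (by omega)
    have hstep := he d le_rfl hdj
    rw [show d - 1 = k + 1 by omega, ← heq] at hstep
    rw [← heq] at he0
    exact Nat.mul_le_mul (by omega) (by omega)
  · have hprev := he (k + 1) (by omega) (by omega)
    have hnext := he (k + 1 + 1) (by omega) hij
    simp only [Nat.add_sub_cancel] at hprev hnext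
    have hle := hmono (k + 1) (by omega) hij
    have hpos := he_nonneg (k + 1) (by omega) (by omega)
    have hprod := mul_nonneg hpos (hpos.trans hle)
    have hscale := mul_le_mul_of_nonneg_left hle (Int.natCast_nonneg (h (k + 1)))
    zify
    rw [show (h k : ℤ) = h (k + 1) + e (k + 1) by linarith,
      show (h (k + 1 + 1) : ℤ) = h (k + 1) - e (k + 1 + 1) by linarith]
    linarith
end

section
/- Let r ≥ 1, t ≥ 1, and j ≥ 2 be integers, and define the compressed level sequence H = (h_0, …, h_j) by h_i = min( C(r−1+i, r−1), t·C(r−1+j−i, r−1) ) for 0 ≤ i ≤ j. Then H is log-concave: h_{i−1}·h_{i+1} ≤ h_i² for all 1 ≤ i ≤ j−1. That is, every compressed level Hilbert function, in any codimension, is log-concave. -/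
theorem choose_add_mul_choose_add_two_le (k n : ℕ) :
    (k + n).choose k * (k + (n + 2)).choose k ≤
      (k + (n + 1)).choose k * (k + (n + 1)).choose k := by
  have h₁ := Nat.choose_mul_succ_eq (k + n) k
  have h₂ := Nat.choose_mul_succ_eq (k + (n + 1)) k
  rw [show k + n + 1 - k = n + 1 by omega, show k + n + 1 = k + (n + 1) by omega] at h₁
  rw [show k + (n + 1) + 1 - k = n + 2 by omega,
    show k + (n + 1) + 1 = k + (n + 2) by omega] at h₂
  generalize (k + n).choose k = x at *
  generalize (k + (n + 1)).choose k = y at *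
  generalize (k + (n + 2)).choose k = z at *
  refine Nat.le_of_mul_le_mul_right (c := (k + (n + 1)) * (n + 2)) ?_ (by positivity)
  calc x * z * ((k + (n + 1)) * (n + 2)) = (x * (k + (n + 1))) * (z * (n + 2)) := by ring
    _ = y * y * ((n + 1) * (k + (n + 2))) := by rw [h₁, ← h₂]; ring
    _ ≤ y * y * ((k + (n + 1)) * (n + 2)) := Nat.mul_le_mul_left _ (by nlinarith)

/-- Every compressed level Hilbert function, in any codimension `r`, is log-concave:
the sequence `h i = min(C(r−1+i, r−1), t·C(r−1+(j−i), r−1))`, `0 ≤ i ≤ j`, is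
log-concave. -/
theorem compressed_level_sequence_log_concave
    (r t j : ℕ) (hr : 1 ≤ r) (ht : 1 ≤ t) (hj : 2 ≤ j)
    (h : ℕ → ℕ)
    (hh : ∀ i ≤ j, h i =
      min (Nat.choose (r - 1 + i) (r - 1)) (t * Nat.choose (r - 1 + (j - i)) (r - 1))) :
    ∀ i : ℕ, 1 ≤ i → i + 1 ≤ j → h (i - 1) * h (i + 1) ≤ h i * h i := by
  intro i hi hij
  obtain ⟨n, rfl⟩ : ∃ n, i = n + 1 := ⟨i - 1, by omega⟩
  obtain ⟨m, rfl⟩ : ∃ m, j = n + 2 + m := ⟨j - (n + 2), by omega⟩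
  rw [Nat.add_sub_cancel, hh n (by omega), hh (n + 1) (by omega), hh (n + 1 + 1) (by omega),
    show n + 2 + m - n = m + 2 by omega, show n + 2 + m - (n + 1) = m + 1 by omega,
    show n + 2 + m - (n + 1 + 1) = m by omega]
  rcases le_total ((r - 1 + (n + 1)).choose (r - 1)) (t * (r - 1 + (m + 1)).choose (r - 1))
    with hle | hle
  · rw [min_eq_left hle]
    exact (Nat.mul_le_mul (min_le_left _ _) (min_le_left _ _)).trans
      (choose_add_mul_choose_add_two_le (r - 1) n)
  · rw [min_eq_right hle]
    refine (Nat.mul_le_mul (min_le_right _ _) (min_le_right _ _)).trans ?_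
    have := Nat.mul_le_mul_left (t * t) (choose_add_mul_choose_add_two_le (r - 1) m)
    linarith
end

section
/- The symmetric sequence H' = (1, 5, 15, 35, 70, 76, 83, 91, 100, 110, 100, 91, 83, 76, 70, 35, 15, 5, 1) of socle degree 18 is an SI sequence (its first difference restricted to degrees 0 through 9, namely (1, 4, 10, 20, 35, 6, 7, 8, 9, 10), is a Macaulay sequence), and it is not log-concave in each of the four consecutive degrees 5, 6, 7, 8: h_4·h_6 = 70·83 = 5810 > 5776 = 76², h_5·h_7 = 76·91 = 6916 > 6889 = 83², h_6·h_8 = 83·100 = 8300 > 8281 = 91², and h_7·h_9 = 91·110 = 10010 > 10000 = 100². Hence there are codimension five SI sequences that fail log-concavity in several adjacent degrees. -/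
/-- Macaulay growth from `b` in degree `a` to `c` holds as soon as `b = C(N, a)` is a single binomial
coefficient and `c ≤ C(N + 1, a + 1)`. -/
theorem exists_macaulay_growth_of_eq_choose {b c a N : ℕ} (ha : 1 ≤ a) (hN : a ≤ N)
    (hb : b = N.choose a) (hc : c ≤ (N + 1).choose (a + 1)) :
    ∃ n : ℕ → ℕ, (∀ i : ℕ, 1 ≤ i → i < a → n i < n (i + 1)) ∧
      b = ∑ i ∈ Finset.Icc 1 a, Nat.choose (n i) i ∧
      c ≤ ∑ i ∈ Finset.Icc 1 a, Nat.choose (n i + 1) (i + 1) := by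
  have hmem : a ∈ Finset.Icc 1 a := Finset.mem_Icc.2 ⟨ha, le_rfl⟩
  refine ⟨fun i => if i = a then N else i - 1, ?_, ?_, ?_⟩
  · intro i hi hia
    dsimp only
    split_ifs <;> omega
  · rw [Finset.sum_eq_single_of_mem a hmem]
    · simpa using hb
    · intro i hi hia
      have := (Finset.mem_Icc.1 hi).1
      simp only [if_neg hia]
      exact Nat.choose_eq_zero_of_lt (by omega)
  · refine le_trans ?_ (Finset.single_le_sum (fun _ _ => Nat.zero_le _) hmem)
    simpa using hc

/-- The symmetric sequence
`H' = (1,5,15,35,70,76,83,91,100,110,100,91,83,76,70,35,15,5,1)` of socle degree 18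
is an SI sequence (so a codimension five SI sequence), and it fails log-concavity in
each of the four consecutive degrees 5, 6, 7, 8. -/
theorem codim_five_si_sequence_four_consecutive_non_log_concave
    (h : ℕ → ℕ)
    (hh : ∀ i : ℕ, h i =
      [1, 5, 15, 35, 70, 76, 83, 91, 100, 110,
       100, 91, 83, 76, 70, 35, 15, 5, 1].getD i 0) :
    IsSISeq h 18 ∧
    h 4 * h 6 > h 5 * h 5 ∧
    h 5 * h 7 > h 6 * h 6 ∧
    h 6 * h 8 > h 7 * h 7 ∧
    h 7 * h 9 > h 8 * h 8 := by
  obtain rfl : h = fun i => [1, 5, 15, 35, 70, 76, 83, 91, 100, 110,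
      100, 91, 83, 76, 70, 35, 15, 5, 1].getD i 0 := funext hh
  refine ⟨⟨by decide, ?_, rfl, ?_⟩, by decide, by decide, by decide, by decide⟩
  · intro i _ hi
    interval_cases i <;> decide
  · intro a ha ha'
    have ha8 : a ≤ 8 := by omega
    refine exists_macaulay_growth_of_eq_choose (N := if a ≤ 4 then a + 3 else a + 1) ha ?_ ?_ ?_
    · split_ifs <;> omega
    all_goals interval_cases a <;> decide
end
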